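/- arXiv:2008.07692 — 2 statements merged into one kernel-verified Lean document; each statement's English description precedes it below -/
import Mathlib

section
/- Let m ≥ 4 and let (n_0,k_0), ..., (n_{m-3},k_{m-3}) ∈ ℕ₀² be such that the numbers 2(n_j + k_j), j = 0, ..., m-3, are pairwise distinct. Then there exist real coefficients a_0, ..., a_{m-3} such that the system (ẋ, ẏ) = ( y, -x + Σ_{j=0}^{m-3} a_j x^{2n_j} y^{2k_j+1} ) has at least m - 3 limit cycles. -/
open Real Set

noncomputable section

/-- `φ` is a solution of the planar ODE `(ẋ,ẏ) = X(x,y)`. -/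
def IsSolution (X : ℝ × ℝ → ℝ × ℝ) (φ : ℝ → ℝ × ℝ) : Prop :=
  ∀ t : ℝ, HasDerivAt φ (X (φ t)) t

/-- `φ` is a (non-constant) periodic orbit of the system `(ẋ,ẏ) = X(x,y)`. -/
def IsPeriodicOrbit (X : ℝ × ℝ → ℝ × ℝ) (φ : ℝ → ℝ × ℝ) : Prop :=
  IsSolution X φ ∧ (∃ T > 0, Function.Periodic φ T) ∧ ¬ (∃ c, ∀ t, φ t = c)

/-- A limit cycle is a periodic orbit that is isolated in the set of all periodic
orbits: it has an open neighbourhood containing no other periodic orbit. -/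
def IsLimitCycle (X : ℝ × ℝ → ℝ × ℝ) (φ : ℝ → ℝ × ℝ) : Prop :=
  IsPeriodicOrbit X φ ∧
  ∃ U : Set (ℝ × ℝ), IsOpen U ∧ Set.range φ ⊆ U ∧
    ∀ ψ : ℝ → ℝ × ℝ, IsPeriodicOrbit X ψ → Set.range ψ ⊆ U →
      Set.range ψ = Set.range φ

/-- The system `(ẋ,ẏ) = X(x,y)` has at least `N` (pairwise distinct) limit cycles. -/
def HasAtLeastNLimitCycles (X : ℝ × ℝ → ℝ × ℝ) (N : ℕ) : Prop :=
  ∃ φ : Fin N → ℝ → ℝ × ℝ, (∀ i, IsLimitCycle X (φ i)) ∧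
    ∀ i j, i ≠ j → Set.range (φ i) ≠ Set.range (φ j)


lemma signVariations_lt_card (P : Polynomial ℝ) (hP : P ≠ 0) :
    P.signVariations + 1 ≤ P.support.card := by
  induction h : P.support.card generalizing P with
  | zero => simp at h; exact absurd h hP
  | succ n ih =>
    by_cases h0 : P.eraseLead = 0
    · have : P = Polynomial.monomial P.natDegree P.leadingCoeff := by
        have := P.eraseLead_add_monomial_natDegree_leadingCoeff
        rw [h0, zero_add] at this
        exact this.symm
      rw [this, Polynomial.signVariations_monomial]; omega
    · have h1 := ih P.eraseLead h0 (Polynomial.card_support_eraseLead' h)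
      have h2 := P.signVariations_le_eraseLead_succ
      omega

lemma roots_exist (N : ℕ) (e : Fin (N+1) → ℕ) (he : Function.Injective e) :
    ∃ β : Fin (N+1) → ℝ, ∀ i : Fin N, ∑ j, β j * ((i:ℝ)+1)^(e j) = 0 ∧
      ∑ j, β j * ((e j : ℝ) * ((i:ℝ)+1)^(e j - 1)) ≠ 0 := by
  let L : (Fin (N+1) → ℝ) →ₗ[ℝ] (Fin N → ℝ) :=
    Matrix.toLin' (Matrix.of fun (i : Fin N) (j : Fin (N+1)) => ((i:ℝ)+1)^(e j))
  have hk : LinearMap.ker L ≠ ⊥ := LinearMap.ker_ne_bot_of_finrank_lt (by simp)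
  obtain ⟨β, hβ, hβ0⟩ := Submodule.exists_mem_ne_zero_of_ne_bot hk
  refine ⟨β, ?_⟩
  have hroot : ∀ i : Fin N, ∑ j, β j * ((i:ℝ)+1)^(e j) = 0 := by
    intro i
    have := congrFun (LinearMap.mem_ker.1 hβ) i
    simp only [L, Matrix.toLin'_apply, Matrix.mulVec, dotProduct, Matrix.of_apply, Pi.zero_apply] at this
    rw [← this]; exact Finset.sum_congr rfl fun j _ => mul_comm _ _
  let P : Polynomial ℝ := ∑ j, Polynomial.monomial (e j) (β j)
  have hPc : ∀ j, P.coeff (e j) = β j := by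
    intro j
    simp only [P, Polynomial.finsetSum_coeff, Polynomial.coeff_monomial, he.eq_iff]
    simp
  have hP0 : P ≠ 0 := by
    intro h
    apply hβ0; ext j; rw [← hPc j, h]; simp
  have hev : ∀ x, P.eval x = ∑ j, β j * x^(e j) := by
    intro x; simp [P, Polynomial.eval_finsetSum]
  have hder : ∀ x, P.derivative.eval x = ∑ j, β j * ((e j : ℝ) * x^(e j - 1)) := by
    intro x; simp [P, Polynomial.eval_finsetSum, Polynomial.derivative_monomial, mul_assoc]
  have hcard : P.support.card ≤ N + 1 := by
    have : P.support ⊆ Finset.image e Finset.univ := by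
      intro n hn
      by_contra hc
      simp only [Finset.mem_image, Finset.mem_univ, true_and, not_exists] at hc
      apply Polynomial.mem_support_iff.1 hn
      simp only [P, Polynomial.finsetSum_coeff, Polynomial.coeff_monomial]
      exact Finset.sum_eq_zero fun j _ => by simp [hc j]
    calc _ ≤ _ := Finset.card_le_card this
      _ ≤ _ := Finset.card_image_le
      _ = N + 1 := by simp
  have hcount : P.roots.countP (0 < ·) ≤ N := by
    have h1 := P.roots_countP_pos_le_signVariations
    have h2 := signVariations_lt_card P hP0
    omega
  intro i
  refine ⟨hroot i, fun hd => ?_⟩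
  -- multiset of roots
  let S : Multiset ℝ := ((i:ℝ)+1) ::ₘ (Finset.univ.image (fun i : Fin N => (i:ℝ)+1)).val
  have hinj : Function.Injective (fun i : Fin N => (i:ℝ)+1) := by
    intro a b h; simpa [Fin.ext_iff] using h
  have hS : S ≤ P.roots := by
    rw [Multiset.le_iff_count]
    intro x
    simp only [S, Multiset.count_cons, Polynomial.count_roots]
    have hnd := (Finset.univ.image (fun i : Fin N => (i:ℝ)+1)).nodup
    by_cases hx : x = (i:ℝ)+1
    · subst hx
      have h1 : 1 < P.rootMultiplicity ((i:ℝ)+1) := by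
        rw [Polynomial.one_lt_rootMultiplicity_iff_isRoot hP0]
        exact ⟨by rw [Polynomial.IsRoot, hev]; exact hroot i,
          by rw [Polynomial.IsRoot, hder]; exact hd⟩
      have h2 := Multiset.nodup_iff_count_le_one.1 hnd ((i:ℝ)+1)
      simp only [if_true]
      omega
    · simp only [hx, if_false, add_zero]
      by_cases hm : x ∈ (Finset.univ.image (fun i : Fin N => (i:ℝ)+1)).val
      · have h2 := Multiset.nodup_iff_count_le_one.1 hnd x
        refine h2.trans ?_
        rw [Nat.succ_le_iff, Polynomial.rootMultiplicity_pos hP0]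
        rw [Finset.mem_val, Finset.mem_image] at hm
        obtain ⟨k, -, rfl⟩ := hm
        rw [Polynomial.IsRoot, hev]; exact hroot k
      · rw [Multiset.count_eq_zero_of_notMem hm]; exact zero_le
  have hc := Multiset.countP_le_of_le (0 < ·) hS
  have hall : S.countP (0 < ·) = S.card := by
    rw [Multiset.countP_eq_card]
    intro a ha
    simp only [S, Multiset.mem_cons] at ha
    rcases ha with rfl | ha
    · positivity
    · rw [Finset.mem_val, Finset.mem_image] at ha
      obtain ⟨k, -, rfl⟩ := ha
      positivity
  have hSc : S.card = N + 1 := by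
    simp only [S, Multiset.card_cons, Finset.card_val]
    rw [Finset.card_image_of_injective _ hinj]; simp
  omega

/-- Inverse of a function with positive derivative. -/
lemma inverse_exists (θ g : ℝ → ℝ) (hθ : ∀ t, HasDerivAt θ (g t) t) (c : ℝ) (hc : 0 < c)
    (hg : ∀ t, c ≤ g t) :
    ∃ σ : ℝ → ℝ, (∀ t, σ (θ t) = t) ∧ (∀ s, θ (σ s) = s) ∧
      ∀ s, HasDerivAt σ (g (σ s))⁻¹ s := by
  have hcont : Continuous θ := continuous_iff_continuousAt.2 fun t => (hθ t).continuousAt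
  have hmono : StrictMono θ := strictMono_of_deriv_pos fun t => by
    rw [(hθ t).deriv]; exact hc.trans_le (hg t)
  have hlow : Monotone (fun t => θ t - c * t) := by
    refine monotone_of_deriv_nonneg ?_ ?_
    · exact fun t => ((hθ t).sub ((hasDerivAt_id t).const_mul c)).differentiableAt
    · intro t
      have := ((hθ t).sub ((hasDerivAt_id t).const_mul c)).deriv
      simp only [mul_one] at this
      have h2 : deriv (fun t => θ t - c * t) t = g t - c := this
      rw [h2]; linarith [hg t]
  have hsurj : Function.Surjective θ := by
    refine hcont.surjective ?_ ?_
    · refine Filter.tendsto_atTop_mono' Filter.atTop (f₁ := fun t => θ 0 + c * t) ?_ ?_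
      · filter_upwards [Filter.eventually_ge_atTop 0] with t ht
        have := hlow ht; simp only at this; linarith
      · exact Filter.tendsto_atTop_add_const_left _ _ (Filter.tendsto_id.const_mul_atTop hc)
    · refine Filter.tendsto_atBot_mono' Filter.atBot (f₁ := fun t => θ 0 + c * t) ?_ ?_
      · filter_upwards [Filter.eventually_le_atBot 0] with t ht
        have := hlow ht; simp only at this; linarith
      · exact Filter.tendsto_atBot_add_const_left _ _ (Filter.tendsto_id.const_mul_atBot hc)
  let E := StrictMono.orderIsoOfSurjective θ hmono hsurj
  have hr : ∀ s, θ (E.symm s) = s := fun s => E.apply_symm_apply s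
  refine ⟨E.symm, fun t => E.symm_apply_apply t, hr, fun s => ?_⟩
  exact HasDerivAt.of_local_left_inverse E.symm.continuous.continuousAt (hθ _)
    (hc.trans_le (hg _)).ne' (Filter.Eventually.of_forall hr)

lemma global_solution (G : ℝ → ℝ → ℝ) (K L : NNReal) (hK : ∀ t, LipschitzWith K (G t))
    (hc : ∀ x, Continuous (fun t => G t x)) (hb : ∀ t x, |G t x| ≤ L) (c : ℝ) :
    ∃ v : ℝ → ℝ, v 0 = c ∧ ∀ t, HasDerivAt v (G t (v t)) t := by
  have hex : ∀ n : ℕ, ∃ w : ℝ → ℝ, w 0 = c ∧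
      ∀ t ∈ Ioo (-((n:ℝ)+1)) ((n:ℝ)+1), HasDerivAt w (G t (w t)) t := by
    intro n
    have hn : (0:ℝ) ≤ (n:ℝ)+1 := by positivity
    have h0 : (0:ℝ) ∈ Icc (-((n:ℝ)+1)) ((n:ℝ)+1) := ⟨by linarith, hn⟩
    have hPL : IsPicardLindelof G (tmin := -((n:ℝ)+1)) (tmax := (n:ℝ)+1) ⟨0, h0⟩ c
        (L * (n+1)) 0 L K :=
      { lipschitzOnWith := fun t _ => (hK t).lipschitzOnWith
        continuousOn := fun x _ => (hc x).continuousOn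
        norm_le := fun t _ x _ => hb t x
        mul_max_le := by simp }
    obtain ⟨w, hw0, hw⟩ := hPL.exists_eq_forall_mem_Icc_hasDerivWithinAt₀
    exact ⟨w, hw0, fun t ht => (hw t (Ioo_subset_Icc_self ht)).hasDerivAt
      (Icc_mem_nhds ht.1 ht.2)⟩
  choose w hw0 hw using hex
  have hagree : ∀ n k : ℕ, n ≤ k → ∀ t ∈ Ioo (-((n:ℝ)+1)) ((n:ℝ)+1), w n t = w k t := by
    intro n k hnk
    have hnk' : (n:ℝ) ≤ k := by exact_mod_cast hnk
    have hn : (0:ℝ) ≤ n := by positivity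
    refine ODE_solution_unique_of_mem_Ioo (v := G) (s := fun _ => univ) (K := K) (t₀ := 0)
      (fun t _ => (hK t).lipschitzOnWith) ⟨by linarith, by linarith⟩
      (fun t ht => ⟨hw n t ht, trivial⟩)
      (fun t ht => ⟨hw k t ⟨by linarith [ht.1], by linarith [ht.2]⟩, trivial⟩) ?_
    rw [hw0, hw0]
  have hagree' : ∀ n k : ℕ, ∀ t, |t| < (n:ℝ)+1 → |t| < (k:ℝ)+1 → w n t = w k t := by
    intro n k t hn hk
    rcases le_total n k with h | h
    · exact hagree n k h t (abs_lt.1 hn)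
    · exact (hagree k n h t (abs_lt.1 hk)).symm
  have hceil : ∀ t : ℝ, |t| < (⌈|t|⌉₊:ℝ)+1 := fun t => by linarith [Nat.le_ceil |t|]
  refine ⟨fun t => w ⌈|t|⌉₊ t, by simp [hw0], fun t => ?_⟩
  refine (hw _ t (abs_lt.1 (hceil t))).congr_of_eventuallyEq ?_
  have : ∀ᶠ s in nhds t, |s| < (⌈|t|⌉₊:ℝ)+1 :=
    (continuous_abs.tendsto t).eventually_lt_const (hceil t)
  filter_upwards [this] with s hs
  exact hagree' _ _ s (hceil s) hs

lemma growth (w w' a : ℝ → ℝ) (b : ℝ) (ha : Continuous a)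
    (hw : ∀ t, HasDerivAt w (w' t) t) (hb : ∀ t, |w' t - a t * w t| ≤ b * |w t|)
    (s t : ℝ) (hst : s ≤ t) :
    |w t| ≤ |w s| * exp ((∫ x in s..t, a x) + b * (t - s)) := by
  have hI : ∀ x, HasDerivAt (fun x => ∫ y in s..x, a y) (a x) x := fun x =>
    intervalIntegral.integral_hasDerivAt_right (ha.intervalIntegrable _ _)
      (ha.stronglyMeasurableAtFilter _ _) ha.continuousAt
  have hz : ∀ x, HasDerivAt (fun x => w x * exp (-∫ y in s..x, a y))
      ((w' x - a x * w x) * exp (-∫ y in s..x, a y)) x := by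
    intro x
    have := (hw x).mul (hI x).neg.exp
    refine this.congr_deriv ?_
    simp only [Pi.neg_apply]
    ring
  have := norm_le_gronwallBound_of_norm_deriv_right_le (f := fun x => w x * exp (-∫ y in s..x, a y))
    (f' := fun x => (w' x - a x * w x) * exp (-∫ y in s..x, a y)) (δ := |w s|) (K := b) (ε := 0)
    (a := s) (b := t)
    (fun x _ => (hz x).continuousAt.continuousWithinAt) (fun x _ => (hz x).hasDerivWithinAt)
    (by simp) (by
      intro x _
      simp only [norm_mul, Real.norm_eq_abs, abs_exp, add_zero]
      rw [← mul_assoc]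
      exact mul_le_mul_of_nonneg_right (hb x) (exp_pos _).le) t ⟨hst, le_rfl⟩
  rw [gronwallBound_ε0] at this
  simp only [norm_mul, Real.norm_eq_abs, abs_exp] at this
  rw [exp_neg, ← div_eq_mul_inv, div_le_iff₀ (exp_pos _)] at this
  rw [exp_add]
  linarith

lemma growth_rev (w w' a : ℝ → ℝ) (b : ℝ) (ha : Continuous a)
    (hw : ∀ t, HasDerivAt w (w' t) t) (hb : ∀ t, |w' t - a t * w t| ≤ b * |w t|)
    (s t : ℝ) (hst : s ≤ t) :
    |w s| ≤ |w t| * exp (-(∫ x in s..t, a x) + b * (t - s)) := by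
  have h := growth (fun x => w (-x)) (fun x => - w' (-x)) (fun x => - a (-x)) b
    (ha.comp continuous_neg).neg (fun x => by
      have := (hw (-x)).scomp x (hasDerivAt_neg x)
      simpa [Function.comp_def] using this) (fun x => by
        have := hb (-x)
        rw [← abs_neg]
        convert this using 2
        ring) (-t) (-s) (by linarith)
  simp only [neg_neg] at h
  rw [intervalIntegral.integral_neg, intervalIntegral.integral_comp_neg (fun x => a x)] at h
  simp only [neg_neg] at h
  convert h using 4
  ring

lemma periodic_unique (G : ℝ → ℝ → ℝ) (I : Set ℝ) (a : ℝ → ℝ) (b : ℝ) (ha : Continuous a)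
    (hap : Function.Periodic a (2*π))
    (hD : b * (2*π) < |∫ x in (0:ℝ)..(2*π), a x|)
    (hG : ∀ t, ∀ u ∈ I, ∀ v ∈ I, |G t u - G t v - a t * (u - v)| ≤ b * |u - v|)
    (v₁ v₂ : ℝ → ℝ) (h₁ : ∀ t, HasDerivAt v₁ (G t (v₁ t)) t)
    (h₂ : ∀ t, HasDerivAt v₂ (G t (v₂ t)) t) (m₁ : ∀ t, v₁ t ∈ I) (m₂ : ∀ t, v₂ t ∈ I)
    (k₁ k₂ : ℕ) (hk₁ : 0 < k₁) (hk₂ : 0 < k₂) (p₁ : Function.Periodic v₁ (k₁ * (2*π)))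
    (p₂ : Function.Periodic v₂ (k₂ * (2*π))) : v₁ = v₂ := by
  set D := ∫ x in (0:ℝ)..(2*π), a x with hDdef
  have hIntegral : ∀ t, ∫ x in t..(t + 2*π), a x = D := fun t => by
    rw [hap.intervalIntegral_add_eq t 0, zero_add]
  have hw : ∀ t, HasDerivAt (fun t => v₁ t - v₂ t) (G t (v₁ t) - G t (v₂ t)) t :=
    fun t => (h₁ t).sub (h₂ t)
  have hb : ∀ t, |(G t (v₁ t) - G t (v₂ t)) - a t * (v₁ t - v₂ t)| ≤ b * |v₁ t - v₂ t| :=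
    fun t => hG t _ (m₁ t) _ (m₂ t)
  have p : Function.Periodic (fun t => v₁ t - v₂ t) (((k₁ * k₂ : ℕ):ℝ) * (2*π)) := by
    intro t
    have e1 := p₁.nat_mul k₂ t
    have e2 := p₂.nat_mul k₁ t
    simp only [] at e1 e2 ⊢
    rw [← e1, ← e2]; push_cast; ring_nf
  have hk : 0 < k₁ * k₂ := Nat.mul_pos hk₁ hk₂
  have hpi : (0:ℝ) < 2 * π := by positivity
  funext t
  by_contra hne
  have hpos : 0 < |v₁ t - v₂ t| := abs_pos.2 (sub_ne_zero.2 hne)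
  have hit : ∀ q : ℝ, 0 ≤ q → (∀ s, |v₁ (s + 2*π) - v₂ (s+2*π)| ≤ q * |v₁ s - v₂ s|) →
      ∀ n : ℕ, |v₁ (t + n * (2*π)) - v₂ (t + n * (2*π))| ≤ q^n * |v₁ t - v₂ t| := by
    intro q hq hs n
    induction n with
    | zero => simp
    | succ n ih =>
      have := hs (t + n * (2*π))
      have e : t + ((n+1:ℕ):ℝ) * (2*π) = t + n * (2*π) + 2 * π := by push_cast; ring
      rw [e]
      calc _ ≤ _ := this
        _ ≤ q * (q^n * |v₁ t - v₂ t|) := mul_le_mul_of_nonneg_left ih hq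
        _ = _ := by ring
  have hit' : ∀ q : ℝ, 0 ≤ q → (∀ s, |v₁ s - v₂ s| ≤ q * |v₁ (s + 2*π) - v₂ (s+2*π)|) →
      ∀ n : ℕ, |v₁ t - v₂ t| ≤ q^n * |v₁ (t + n * (2*π)) - v₂ (t + n * (2*π))| := by
    intro q hq hs n
    induction n with
    | zero => simp
    | succ n ih =>
      have := hs (t + n * (2*π))
      have e : t + ((n+1:ℕ):ℝ) * (2*π) = t + n * (2*π) + 2 * π := by push_cast; ring
      rw [e]
      calc _ ≤ _ := ih
        _ ≤ q^n * (q * |v₁ (t + n * (2*π) + 2*π) - v₂ (t + n * (2*π) + 2*π)|) :=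
          mul_le_mul_of_nonneg_left this (by positivity)
        _ = _ := by ring
  have hper := p t
  simp only [] at hper
  rcases lt_or_ge D 0 with hneg | hnn
  · rw [abs_of_neg hneg] at hD
    have h := hit (exp (D + b * (2*π))) (exp_pos _).le (fun s => by
      have := growth _ _ a b ha hw hb s (s + 2*π) (by linarith)
      rw [hIntegral] at this
      rw [mul_comm (exp _)]
      simpa using this) (k₁ * k₂)
    rw [hper] at h
    have hq : exp (D + b * (2*π)) ^ (k₁*k₂) < 1 :=
      pow_lt_one₀ (exp_pos _).le (by rw [← Real.exp_zero]; exact Real.exp_lt_exp.2 (by linarith)) hk.ne'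
    nlinarith
  · rw [abs_of_nonneg hnn] at hD
    have h := hit' (exp (-D + b * (2*π))) (exp_pos _).le (fun s => by
      have := growth_rev _ _ a b ha hw hb s (s + 2*π) (by linarith)
      rw [hIntegral] at this
      rw [mul_comm (exp _)]
      simpa using this) (k₁ * k₂)
    rw [hper] at h
    have hq : exp (-D + b * (2*π)) ^ (k₁*k₂) < 1 :=
      pow_lt_one₀ (exp_pos _).le (by rw [← Real.exp_zero]; exact Real.exp_lt_exp.2 (by linarith)) hk.ne'
    nlinarith

lemma periodic_exists (G : ℝ → ℝ → ℝ) (R δ : ℝ) (hδ : 0 < δ) (a : ℝ → ℝ) (b A M κ : ℝ)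
    (ha : Continuous a) (hA : ∀ t, |a t| ≤ A) (hb0 : 0 ≤ b)
    (hGp : ∀ u, Function.Periodic (fun t => G t u) (2*π))
    (hGc : ∀ u ∈ Icc (R-δ) (R+δ), Continuous (fun t => G t u))
    (hM : ∀ t, ∀ u ∈ Icc (R-δ) (R+δ), |G t u| ≤ M) (hMδ : M * (2*π) < δ/2)
    (hG : ∀ t, ∀ u ∈ Icc (R-δ) (R+δ), ∀ v ∈ Icc (R-δ) (R+δ),
      |G t u - G t v - a t * (u - v)| ≤ b * |u - v|)
    (hκ : |∫ x in (0:ℝ)..(2*π), G x R| ≤ κ)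
    (hD : κ + (b * δ + A * (M * (2*π))) * (2*π) < |∫ x in (0:ℝ)..(2*π), a x| * (δ/2)) :
    ∃ v : ℝ → ℝ, (∀ t, HasDerivAt v (G t (v t)) t) ∧ Function.Periodic v (2*π) ∧
      ∀ t, v t ∈ Ioo (R-δ) (R+δ) := by
  set D := ∫ x in (0:ℝ)..(2*π), a x with hDdef
  have hpi : (0:ℝ) < 2 * π := by positivity
  have hA0 : 0 ≤ A := (abs_nonneg _).trans (hA 0)
  have hRm : R ∈ Icc (R-δ) (R+δ) := ⟨by linarith, by linarith⟩
  have hM0 : 0 ≤ M := (abs_nonneg _).trans (hM 0 R hRm)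
  have hle : R - δ ≤ R + δ := by linarith
  let pr : ℝ → ℝ := fun u => (projIcc (R-δ) (R+δ) hle u : ℝ)
  have prm : ∀ u, pr u ∈ Icc (R-δ) (R+δ) := fun u => (projIcc (R-δ) (R+δ) hle u).2
  have prid : ∀ u ∈ Icc (R-δ) (R+δ), pr u = u := fun u hu => by
    simp only [pr]; rw [projIcc_of_mem hle hu]
  have prlip : ∀ u v, |pr u - pr v| ≤ |u - v| := fun u v => abs_projIcc_sub_projIcc hle
  have hlip : ∀ t, LipschitzWith (A + b).toNNReal (fun u => G t (pr u)) := by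
    intro t
    refine LipschitzWith.of_dist_le_mul fun u v => ?_
    rw [Real.dist_eq, Real.dist_eq, Real.coe_toNNReal _ (by linarith)]
    have h1 := hG t _ (prm u) _ (prm v)
    have h2 : |a t * (pr u - pr v)| ≤ A * |pr u - pr v| := by
      rw [abs_mul]; exact mul_le_mul_of_nonneg_right (hA t) (abs_nonneg _)
    calc |G t (pr u) - G t (pr v)|
        = |(G t (pr u) - G t (pr v) - a t * (pr u - pr v)) + a t * (pr u - pr v)| := by ring_nf
      _ ≤ _ := abs_add_le _ _
      _ ≤ (A + b) * |pr u - pr v| := by linarith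
      _ ≤ _ := mul_le_mul_of_nonneg_left (prlip u v) (by linarith)
  have hsol := fun c => global_solution (fun t u => G t (pr u)) (A + b).toNNReal M.toNNReal hlip
    (fun u => hGc _ (prm u)) (fun t u => by
      rw [Real.coe_toNNReal _ hM0]; exact hM t _ (prm u)) c
  choose V hV0 hV using hsol
  -- small motion
  have hmove : ∀ c, ∀ t ∈ Icc (0:ℝ) (2*π), |V c t - c| ≤ M * (2*π) := by
    intro c t ht
    have := (convex_Icc (0:ℝ) (2*π)).norm_image_sub_le_of_norm_hasDerivWithin_le
      (f := V c) (C := M) (fun x _ => (hV c x).hasDerivWithinAt)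
      (fun x _ => hM x _ (prm _)) ⟨le_rfl, hpi.le⟩ ht
    rw [hV0, Real.norm_eq_abs, Real.norm_eq_abs, sub_zero, abs_of_nonneg ht.1] at this
    exact this.trans (mul_le_mul_of_nonneg_left ht.2 hM0)
  have hin : ∀ c ∈ Icc (R-δ/2) (R+δ/2), ∀ t ∈ Icc (0:ℝ) (2*π), V c t ∈ Ioo (R-δ) (R+δ) := by
    intro c hc t ht
    have := abs_le.1 (hmove c t ht)
    exact ⟨by linarith [hc.1, this.1], by linarith [hc.2, this.2]⟩
  have hdisp : ∀ c ∈ Icc (R-δ/2) (R+δ/2), |V c (2*π) - c - D * (c - R)| < |D| * (δ/2) := by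
    intro c hc
    have hI1 : ∀ x, HasDerivAt (fun x => ∫ y in (0:ℝ)..x, a y) (a x) x := fun x =>
      intervalIntegral.integral_hasDerivAt_right (ha.intervalIntegrable _ _)
        (ha.stronglyMeasurableAtFilter _ _) ha.continuousAt
    have hgc := hGc R hRm
    have hI2 : ∀ x, HasDerivAt (fun x => ∫ y in (0:ℝ)..x, G y R) (G x R) x := fun x =>
      intervalIntegral.integral_hasDerivAt_right (hgc.intervalIntegrable _ _)
        (hgc.stronglyMeasurableAtFilter _ _) hgc.continuousAt
    have hE : ∀ x, HasDerivAt (fun x => V c x - (∫ y in (0:ℝ)..x, G y R)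
        - (∫ y in (0:ℝ)..x, a y) * (c - R)) (G x (pr (V c x)) - G x R - a x * (c - R)) x :=
      fun x => ((hV c x).sub (hI2 x)).sub ((hI1 x).mul_const _)
    have := (convex_Icc (0:ℝ) (2*π)).norm_image_sub_le_of_norm_hasDerivWithin_le
      (C := b * δ + A * (M * (2*π))) (fun x _ => (hE x).hasDerivWithinAt)
      (fun x hx => by
        have hx' := Ioo_subset_Icc_self (hin c hc x hx)
        rw [prid _ hx', Real.norm_eq_abs]
        have e1 := hG x _ hx' R hRm
        have e2 : |V c x - R| ≤ δ := abs_le.2 ⟨by linarith [hx'.1], by linarith [hx'.2]⟩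
        have e3 : |a x * (V c x - c)| ≤ A * (M * (2*π)) := by
          rw [abs_mul]
          exact mul_le_mul (hA x) (hmove c x hx) (abs_nonneg _) hA0
        calc _ = |(G x (V c x) - G x R - a x * (V c x - R)) + a x * (V c x - c)| := by ring_nf
          _ ≤ _ := abs_add_le _ _
          _ ≤ _ := add_le_add (e1.trans (mul_le_mul_of_nonneg_left e2 hb0)) e3)
      (⟨le_rfl, hpi.le⟩ : (0:ℝ) ∈ Icc (0:ℝ) (2*π)) (⟨hpi.le, le_rfl⟩ : 2*π ∈ Icc (0:ℝ) (2*π))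
    simp only [intervalIntegral.integral_same, hV0, sub_zero, zero_mul, Real.norm_eq_abs] at this
    rw [abs_of_pos hpi, ← hDdef] at this
    calc |V c (2*π) - c - D * (c - R)|
        = |(V c (2*π) - (∫ x in (0:ℝ)..(2*π), G x R) - D * (c - R) - c)
            + ∫ x in (0:ℝ)..(2*π), G x R| := by ring_nf
      _ ≤ _ := abs_add_le _ _
      _ ≤ (b * δ + A * (M * (2*π))) * (2*π) + κ := add_le_add this hκ
      _ < _ := by linarith
  have hcont : Continuous (fun c => V c (2*π) - c) := by
    refine Continuous.sub ?_ continuous_id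
    refine (LipschitzWith.of_dist_le_mul (K := ⟨exp ((A+b).toNNReal * (2*π)), (exp_pos _).le⟩)
      fun c d => ?_).continuous
    have := dist_le_of_trajectories_ODE (v := fun t u => G t (pr u)) (K := (A+b).toNNReal)
      (f := V c) (g := V d) (a := 0) (b := 2*π) (δ := dist c d) hlip
      (fun x _ => (hV c x).continuousAt.continuousWithinAt)
      (fun x _ => (hV c x).hasDerivWithinAt)
      (fun x _ => (hV d x).continuousAt.continuousWithinAt)
      (fun x _ => (hV d x).hasDerivWithinAt) (by rw [hV0, hV0]) (2*π) ⟨hpi.le, le_rfl⟩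
    rw [sub_zero, mul_comm (dist c d)] at this
    exact this
  have hz : ∃ c ∈ Icc (R-δ/2) (R+δ/2), V c (2*π) - c = 0 := by
    have hle2 : R - δ/2 ≤ R + δ/2 := by linarith
    have d1 := abs_lt.1 (hdisp (R-δ/2) ⟨le_rfl, hle2⟩)
    have d2 := abs_lt.1 (hdisp (R+δ/2) ⟨hle2, le_rfl⟩)
    have e1 : D * (R - δ/2 - R) = - (D * (δ/2)) := by ring
    have e2 : D * (R + δ/2 - R) = D * (δ/2) := by ring
    rw [e1] at d1
    rw [e2] at d2
    rcases lt_or_ge D 0 with hneg | hnn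
    · rw [abs_of_neg hneg] at d1 d2
      obtain ⟨c, hc, h0⟩ := intermediate_value_Icc' hle2 hcont.continuousOn
        (show (0:ℝ) ∈ Icc _ _ from ⟨by linarith [d2.2], by linarith [d1.1]⟩)
      exact ⟨c, hc, h0⟩
    · rw [abs_of_nonneg hnn] at d1 d2
      obtain ⟨c, hc, h0⟩ := intermediate_value_Icc hle2 hcont.continuousOn
        (show (0:ℝ) ∈ Icc _ _ from ⟨by linarith [d1.2], by linarith [d2.1]⟩)
      exact ⟨c, hc, h0⟩
  obtain ⟨c, hc, h0⟩ := hz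
  have hper : Function.Periodic (V c) (2*π) := by
    have : (fun t => V c (t + 2*π)) = V c := by
      refine ODE_solution_unique_univ (v := fun t u => G t (pr u)) (s := fun _ => univ)
        (K := (A+b).toNNReal) (t₀ := 0) (fun t => (hlip t).lipschitzOnWith) (fun t => ⟨?_, trivial⟩)
        (fun t => ⟨hV c t, trivial⟩) ?_
      · have := (hV c (t + 2*π)).comp_add_const t (2*π)
        have e := hGp (pr (V c (t+2*π))) t
        simp only [] at e
        rw [e] at this
        exact this
      · simp only [zero_add, hV0]; linarith
    exact fun t => congrFun this t
  have hmem : ∀ t, V c t ∈ Ioo (R-δ) (R+δ) := by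
    intro t
    obtain ⟨y, hy, he⟩ := hper.exists_mem_Ico₀ hpi t
    rw [he]; exact hin c hc y (Ico_subset_Icc_self hy)
  refine ⟨V c, fun t => ?_, hper, hmem⟩
  have := hV c t
  rwa [prid _ (Ioo_subset_Icc_self (hmem t))] at this
/-- the polar angular equation -/
def polarField (C : ℝ → ℝ → ℝ → ℝ) (θ u : ℝ) : ℝ :=
  2 * u * cos θ * C (sin θ) (cos θ) u / (1 - sin θ * C (sin θ) (cos θ) u)

lemma abs_mul_le_half (s C : ℝ) (hs : |s| ≤ 1) (hC : |C| ≤ 1/2) : |s * C| ≤ 1/2 := by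
  rw [abs_mul]
  calc _ ≤ 1 * (1/2 : ℝ) := mul_le_mul hs hC (abs_nonneg _) zero_le_one
    _ = _ := by ring

lemma bridge1 (g : ℝ → ℝ → ℝ) (C : ℝ → ℝ → ℝ → ℝ)
    (hCc : Continuous (fun q : ℝ × ℝ × ℝ => C q.1 q.2.1 q.2.2))
    (hg : ∀ u > 0, ∀ s c, g (√u * s) (√u * c) = √u * C s c u)
    (v : ℝ → ℝ) (hpos : ∀ θ, 0 < v θ) (hper : Function.Periodic v (2*π))
    (hC : ∀ θ, |C (sin θ) (cos θ) (v θ)| ≤ 1/2)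
    (hv : ∀ θ, HasDerivAt v (polarField C θ (v θ)) θ) :
    ∃ φ : ℝ → ℝ × ℝ, IsPeriodicOrbit (fun p => (p.2, -p.1 + g p.1 p.2)) φ ∧
      range φ = range (fun θ => ((√(v θ) * sin θ, √(v θ) * cos θ) : ℝ × ℝ)) := by
  have hvc : Continuous v := continuous_iff_continuousAt.2 fun t => (hv t).continuousAt
  let Q : ℝ → ℝ := fun θ => 1 - sin θ * C (sin θ) (cos θ) (v θ)
  have hQc : Continuous Q := by
    have : Continuous (fun θ => C (sin θ) (cos θ) (v θ)) :=
      hCc.comp (continuous_sin.prodMk (continuous_cos.prodMk hvc))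
    exact continuous_const.sub (continuous_sin.mul this)
  have hQ : ∀ θ, 1/2 ≤ Q θ ∧ Q θ ≤ 2 := fun θ => by
    have := abs_le.1 (abs_mul_le_half _ _ (abs_sin_le_one θ) (hC θ))
    simp only [Q]
    exact ⟨by linarith, by linarith⟩
  have hQ0 : ∀ θ, 0 < Q θ := fun θ => by linarith [(hQ θ).1]
  have hQi : Continuous (fun θ => (Q θ)⁻¹) := hQc.inv₀ fun θ => (hQ0 θ).ne'
  have hQp : Function.Periodic (fun θ => (Q θ)⁻¹) (2*π) := by
    intro θ
    simp only [Q, sin_add_two_pi, cos_add_two_pi, hper θ]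
  let τ : ℝ → ℝ := fun θ => ∫ x in (0:ℝ)..θ, (Q x)⁻¹
  have hτ : ∀ θ, HasDerivAt τ (Q θ)⁻¹ θ := fun x =>
      intervalIntegral.integral_hasDerivAt_right (hQi.intervalIntegrable _ _)
        (hQi.stronglyMeasurableAtFilter _ _) hQi.continuousAt
  obtain ⟨σ, hl, hr, hσ⟩ := inverse_exists τ _ hτ (1/2) (by norm_num) (fun θ => by
    have := inv_anti₀ (hQ0 θ) (hQ θ).2
    norm_num at this ⊢; exact this)
  have hτp : ∀ θ, τ (θ + 2*π) = τ θ + τ (2*π) := by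
    intro θ
    have h1 := intervalIntegral.integral_add_adjacent_intervals
      (hQi.intervalIntegrable (μ := MeasureTheory.volume) 0 θ)
      (hQi.intervalIntegrable (μ := MeasureTheory.volume) θ (θ + 2*π))
    have h2 := hQp.intervalIntegral_add_eq θ 0
    rw [zero_add] at h2
    simp only [τ]
    rw [← h1, h2]
  have hT : 0 < τ (2*π) :=
    intervalIntegral.intervalIntegral_pos_of_pos (hQi.intervalIntegrable _ _)
      (fun x => inv_pos.2 (hQ0 x)) (by positivity)
  have hσp : ∀ t, σ (t + τ (2*π)) = σ t + 2*π := by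
    intro t
    rw [← hl (σ t + 2*π), hτp, hr]
  let P : ℝ → ℝ × ℝ := fun θ => (√(v θ) * sin θ, √(v θ) * cos θ)
  have hPp : Function.Periodic P (2*π) := by
    intro θ; simp only [P, sin_add_two_pi, cos_add_two_pi, hper θ]
  have hrange : range (fun t => P (σ t)) = range P := by
    have hs : Function.Surjective σ := fun θ => ⟨τ θ, hl θ⟩
    exact hs.range_comp P
  refine ⟨fun t => P (σ t), ⟨?_, ⟨τ (2*π), hT, ?_⟩, ?_⟩, hrange⟩
  · intro t
    have hσ' : HasDerivAt σ (Q (σ t)) t := by simpa using hσ t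
    have hsq : HasDerivAt (fun t => √(v (σ t)))
        (polarField C (σ t) (v (σ t)) * Q (σ t) / (2 * √(v (σ t)))) t :=
      ((hv (σ t)).comp t hσ').sqrt (hpos _).ne'
    have h1 := hsq.mul hσ'.sin
    have h2 := hsq.mul hσ'.cos
    have hF : polarField C (σ t) (v (σ t)) * Q (σ t)
        = 2 * v (σ t) * cos (σ t) * C (sin (σ t)) (cos (σ t)) (v (σ t)) := by
      simp only [polarField]
      exact div_mul_cancel₀ _ (hQ0 (σ t)).ne'
    rw [hF] at h1 h2
    have hr0 : 0 < √(v (σ t)) := sqrt_pos.2 (hpos _)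
    have hr2 : √(v (σ t)) ^ 2 = v (σ t) := sq_sqrt (hpos _).le
    have hdiv : 2 * v (σ t) * cos (σ t) * C (sin (σ t)) (cos (σ t)) (v (σ t)) / (2 * √(v (σ t)))
        = √(v (σ t)) * cos (σ t) * C (sin (σ t)) (cos (σ t)) (v (σ t)) := by
      rw [div_eq_iff (by positivity)]
      linear_combination (-2 * cos (σ t) * C (sin (σ t)) (cos (σ t)) (v (σ t))) * hr2
    rw [hdiv] at h1 h2
    refine (h1.prodMk h2).congr_deriv ?_
    simp only [P, hg _ (hpos (σ t)), Q, Prod.mk.injEq]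
    constructor
    · ring
    · linear_combination (√(v (σ t)) * C (sin (σ t)) (cos (σ t)) (v (σ t))) * (sin_sq_add_cos_sq (σ t))
  · intro t
    simp only [hσp]; exact hPp _
  · rintro ⟨c, hc⟩
    have e1 := hc (τ 0)
    have e2 := hc (τ π)
    simp only [hl] at e1 e2
    have := congrArg Prod.snd (e1.trans e2.symm)
    simp only [P, cos_zero, cos_pi] at this
    have h1 : 0 < √(v 0) := sqrt_pos.2 (hpos _)
    have h2 : 0 < √(v π) := sqrt_pos.2 (hpos _)
    linarith

lemma bridge2 (g : ℝ → ℝ → ℝ) (C : ℝ → ℝ → ℝ → ℝ) (I : Set ℝ) (hI : ∀ u ∈ I, 0 < u)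
    (hgc : Continuous (fun p : ℝ × ℝ => g p.1 p.2))
    (hg : ∀ u > 0, ∀ s c, g (√u * s) (√u * c) = √u * C s c u)
    (hC : ∀ θ, ∀ u ∈ I, |C (sin θ) (cos θ) u| ≤ 1/2)
    (ψ : ℝ → ℝ × ℝ) (hψ : IsPeriodicOrbit (fun p => (p.2, -p.1 + g p.1 p.2)) ψ)
    (hm : ∀ t, (ψ t).1^2 + (ψ t).2^2 ∈ I) :
    ∃ v : ℝ → ℝ, (∀ θ, v θ ∈ I) ∧ (∀ θ, HasDerivAt v (polarField C θ (v θ)) θ) ∧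
      (∃ k : ℕ, 0 < k ∧ Function.Periodic v (k * (2*π))) ∧
      range ψ = range (fun θ => ((√(v θ) * sin θ, √(v θ) * cos θ) : ℝ × ℝ)) := by
  obtain ⟨hsol, ⟨T, hT, hper⟩, -⟩ := hψ
  have hψc : Continuous ψ := continuous_iff_continuousAt.2 fun t => (hsol t).continuousAt
  let x : ℝ → ℝ := fun t => (ψ t).1
  let y : ℝ → ℝ := fun t => (ψ t).2
  have hxc : Continuous x := continuous_fst.comp hψc
  have hyc : Continuous y := continuous_snd.comp hψc
  have hx : ∀ t, HasDerivAt x (y t) t := fun t => by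
    have := (hasFDerivAt_fst (𝕜 := ℝ) (p := ψ t)).comp_hasDerivAt t (hsol t)
    exact this
  have hy : ∀ t, HasDerivAt y (-x t + g (x t) (y t)) t := fun t => by
    have := (hasFDerivAt_snd (𝕜 := ℝ) (p := ψ t)).comp_hasDerivAt t (hsol t)
    exact this
  let u : ℝ → ℝ := fun t => x t ^ 2 + y t ^ 2
  have hum : ∀ t, u t ∈ I := hm
  have hupos : ∀ t, 0 < u t := fun t => hI _ (hum t)
  have hu : ∀ t, HasDerivAt u (2 * y t * g (x t) (y t)) t := fun t => by
    refine (((hx t).pow 2).add ((hy t).pow 2)).congr_deriv ?_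
    simp; ring
  let h : ℝ → ℝ := fun t => 1 - x t * g (x t) (y t) / u t
  have hgxy : Continuous (fun t => g (x t) (y t)) := hgc.comp (hxc.prodMk hyc)
  have huc : Continuous u := (hxc.pow 2).add (hyc.pow 2)
  have hhc : Continuous h :=
    continuous_const.sub ((hxc.mul hgxy).div huc fun t => (hupos t).ne')
  obtain ⟨θ0, hx0, hy0⟩ : ∃ θ0, x 0 = √(u 0) * sin θ0 ∧ y 0 = √(u 0) * cos θ0 := by
    refine ⟨Complex.arg ⟨y 0, x 0⟩, ?_, ?_⟩
    · have := Complex.norm_mul_sin_arg ⟨y 0, x 0⟩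
      rw [Complex.norm_eq_sqrt_sq_add_sq] at this
      simp only [u]
      rw [add_comm (x 0 ^ 2)]
      exact this.symm
    · have := Complex.norm_mul_cos_arg ⟨y 0, x 0⟩
      rw [Complex.norm_eq_sqrt_sq_add_sq] at this
      simp only [u]
      rw [add_comm (x 0 ^ 2)]
      exact this.symm
  let θ : ℝ → ℝ := fun t => θ0 + ∫ s in (0:ℝ)..t, h s
  have hθ : ∀ t, HasDerivAt θ (h t) t := fun t =>
      (intervalIntegral.integral_hasDerivAt_right (hhc.intervalIntegrable _ _)
        (hhc.stronglyMeasurableAtFilter _ _) hhc.continuousAt).const_add _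
  have hθ0 : θ 0 = θ0 := by simp [θ]
  let r : ℝ → ℝ := fun t => √(u t)
  have hr0 : ∀ t, 0 < r t := fun t => sqrt_pos.2 (hupos t)
  have hr2 : ∀ t, r t ^ 2 = u t := fun t => sq_sqrt (hupos t).le
  have hr : ∀ t, HasDerivAt r (2 * y t * g (x t) (y t) / (2 * r t)) t := fun t =>
    (hu t).sqrt (hupos t).ne'
  have hp : ∀ t, HasDerivAt (fun t => (x t * cos (θ t) - y t * sin (θ t)) / r t) 0 t := by
    intro t
    have := (((hx t).mul (hθ t).cos).sub ((hy t).mul (hθ t).sin)).div (hr t) (hr0 t).ne'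
    refine this.congr_deriv ?_
    have h1 := (hr0 t).ne'
    have hut : u t = x t ^ 2 + y t ^ 2 := rfl
    have hu0 : r t ^ 2 ≠ 0 := pow_ne_zero _ h1
    simp only [Pi.mul_apply, Pi.sub_apply, h]
    rw [← hr2 t]
    rw [← hr2 t] at hut
    field_simp
    rw [hut]
    ring
  have hq : ∀ t, HasDerivAt (fun t => (x t * sin (θ t) + y t * cos (θ t)) / r t) 0 t := by
    intro t
    have := (((hx t).mul (hθ t).sin).add ((hy t).mul (hθ t).cos)).div (hr t) (hr0 t).ne'
    refine this.congr_deriv ?_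
    have h1 := (hr0 t).ne'
    have hut : u t = x t ^ 2 + y t ^ 2 := rfl
    have hu0 : r t ^ 2 ≠ 0 := pow_ne_zero _ h1
    simp only [Pi.mul_apply, Pi.add_apply, h]
    rw [← hr2 t]
    rw [← hr2 t] at hut
    field_simp
    rw [hut]
    ring
  have hp0 : ∀ t, (x t * cos (θ t) - y t * sin (θ t)) / r t = 0 := by
    intro t
    have := is_const_of_deriv_eq_zero (fun t => (hp t).differentiableAt) (fun t => (hp t).deriv) t 0
    rw [this, hθ0, hx0, hy0, div_eq_zero_iff]
    left; ring
  have hq1 : ∀ t, (x t * sin (θ t) + y t * cos (θ t)) / r t = 1 := by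
    intro t
    have := is_const_of_deriv_eq_zero (fun t => (hq t).differentiableAt) (fun t => (hq t).deriv) t 0
    rw [this, hθ0, hx0, hy0, div_eq_one_iff_eq (hr0 0).ne']
    simp only [r]
    linear_combination (√(u 0)) * sin_sq_add_cos_sq θ0
  have hxr : ∀ t, x t = r t * sin (θ t) := by
    intro t
    have e1 := (div_eq_zero_iff.1 (hp0 t)).resolve_right (hr0 t).ne'
    have e2 := (div_eq_one_iff_eq (hr0 t).ne').1 (hq1 t)
    rw [← e2]
    linear_combination cos (θ t) * e1 - x t * sin_sq_add_cos_sq (θ t)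
  have hyr : ∀ t, y t = r t * cos (θ t) := by
    intro t
    have e1 := (div_eq_zero_iff.1 (hp0 t)).resolve_right (hr0 t).ne'
    have e2 := (div_eq_one_iff_eq (hr0 t).ne').1 (hq1 t)
    rw [← e2]
    linear_combination - sin (θ t) * e1 - y t * sin_sq_add_cos_sq (θ t)
  have hgr : ∀ t, g (x t) (y t) = r t * C (sin (θ t)) (cos (θ t)) (u t) := by
    intro t
    rw [hxr, hyr]; exact hg _ (hupos t) _ _
  have hh : ∀ t, h t = 1 - sin (θ t) * C (sin (θ t)) (cos (θ t)) (u t) := by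
    intro t
    simp only [h]
    rw [hgr, hxr]
    have := hr2 t
    have h3 := (hupos t).ne'
    rw [sub_right_inj, div_eq_iff h3]
    linear_combination (sin (θ t) * C (sin (θ t)) (cos (θ t)) (u t)) * this
  have hhb : ∀ t, 1/2 ≤ h t := by
    intro t
    have := abs_le.1 (abs_mul_le_half _ _ (abs_sin_le_one (θ t)) (hC (θ t) _ (hum t)))
    rw [hh]; linarith
  obtain ⟨σ, hl, hrt, hσ⟩ := inverse_exists θ h hθ (1/2) (by norm_num) hhb
  have hψT : ∀ t, u (t + T) = u t := fun t => by simp only [u, x, y, hper t]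
  have hhT : Function.Periodic h T := fun t => by simp only [h, u, x, y, hper t]
  have hθT : ∀ t, θ (t + T) = θ t + ∫ s in (0:ℝ)..T, h s := by
    intro t
    have h1 := intervalIntegral.integral_add_adjacent_intervals
      (hhc.intervalIntegrable (μ := MeasureTheory.volume) 0 t)
      (hhc.intervalIntegrable (μ := MeasureTheory.volume) t (t + T))
    have h2 := hhT.intervalIntegral_add_eq t 0
    rw [zero_add] at h2
    simp only [θ]
    rw [← h1, h2]; ring
  have hΘ : 0 < ∫ s in (0:ℝ)..T, h s :=
    intervalIntegral.intervalIntegral_pos_of_pos (hhc.intervalIntegrable _ _)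
      (fun s => by linarith [hhb s]) hT
  set Θ := ∫ s in (0:ℝ)..T, h s with hΘdef
  have hcos : cos Θ = 1 := by
    have e1 : x (0 + T) = x 0 := by simp only [x, hper 0]
    have e2 : y (0 + T) = y 0 := by simp only [y, hper 0]
    have e3 : r (0 + T) = r 0 := by simp only [r, hψT]
    rw [hxr, hxr 0, e3, hθT] at e1
    rw [hyr, hyr 0, e3, hθT] at e2
    have f1 := mul_left_cancel₀ (hr0 0).ne' e1
    have f2 := mul_left_cancel₀ (hr0 0).ne' e2
    have : Θ = (θ 0 + Θ) - θ 0 := by ring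
    rw [this, cos_sub, f1, f2]
    linear_combination sin_sq_add_cos_sq (θ 0)
  obtain ⟨n, hn⟩ := (cos_eq_one_iff Θ).1 hcos
  have hnpos : 0 < n := by
    have : (0:ℝ) < n := by
      by_contra hc
      have : (n:ℝ) * (2*π) ≤ 0 := mul_nonpos_of_nonpos_of_nonneg (not_lt.1 hc) (by positivity)
      linarith
    exact_mod_cast this
  have hσT : ∀ s, σ (s + Θ) = σ s + T := by
    intro s
    rw [← hl (σ s + T), hθT, hrt]
  refine ⟨fun s => u (σ s), fun s => hum _, ?_, ⟨n.toNat, by omega, ?_⟩, ?_⟩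
  · intro s
    have := (hu (σ s)).comp s (hσ s)
    refine this.congr_deriv ?_
    simp only [polarField]
    rw [hh, hgr, hyr, hrt, div_eq_mul_inv]
    have := hr2 (σ s)
    rw [← this]; ring
  · intro s
    have e : ((n.toNat : ℕ) : ℝ) = (n : ℝ) := by
      have : ((n.toNat : ℕ) : ℤ) = n := Int.toNat_of_nonneg hnpos.le
      exact_mod_cast congrArg (Int.cast (R := ℝ)) this
    simp only [e, hn, hσT, hψT]
  · have hs : Function.Surjective θ := fun s => ⟨σ s, hrt s⟩
    rw [← hs.range_comp (fun θ => ((√(u (σ θ)) * sin θ, √(u (σ θ)) * cos θ) : ℝ × ℝ))]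
    congr 1
    funext t
    simp only [Function.comp, hl]
    exact Prod.ext (hxr t) (hyr t)

lemma tube (R : ℝ) (Φ : ℝ → ℝ → ℝ → ℝ → ℝ)
    (hΦ : ∀ s c, ContinuousAt (fun q : (ℝ × ℝ) × (ℝ × ℝ) => Φ q.1.1 q.2.1 q.2.2 q.1.2) ((0, R), (s, c)))
    (η : ℝ) (hη : 0 < η) :
    ∃ d > 0, ∀ ε u, |ε| < d → |u - R| < d →
      ∀ θ, |Φ ε (sin θ) (cos θ) u - Φ 0 (sin θ) (cos θ) R| < η := by
  have hK : IsCompact (Icc (-1:ℝ) 1 ×ˢ Icc (-1:ℝ) 1) := isCompact_Icc.prod isCompact_Icc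
  have h := hK.eventually_forall_of_forall_eventually (x₀ := ((0:ℝ), R))
    (P := fun p q => |Φ p.1 q.1 q.2 p.2 - Φ 0 q.1 q.2 R| < η) (by
      rintro ⟨s, c⟩ -
      have h1 := hΦ s c
      have h2 : ContinuousAt (fun q : (ℝ × ℝ) × (ℝ × ℝ) => Φ 0 q.2.1 q.2.2 R) ((0, R), (s, c)) :=
        ContinuousAt.comp (f := fun q : (ℝ × ℝ) × (ℝ × ℝ) => (((0:ℝ), R), q.2))
          (g := fun q : (ℝ × ℝ) × (ℝ × ℝ) => Φ q.1.1 q.2.1 q.2.2 q.1.2)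
          (x := (((0:ℝ), R), (s, c))) h1 (by fun_prop)
      have h3 := (h1.sub h2).abs
      have h4 := h3.tendsto.eventually_lt_const (u := η) (by simpa using hη)
      exact h4)
  obtain ⟨d, hd, hh⟩ := Metric.eventually_nhds_iff.1 h
  refine ⟨d, hd, fun ε u hε hu θ => ?_⟩
  refine hh (y := (ε, u)) ?_ (sin θ, cos θ) ⟨⟨neg_one_le_sin θ, sin_le_one θ⟩, ⟨neg_one_le_cos θ, cos_le_one θ⟩⟩
  rw [Prod.dist_eq, max_lt_iff, Real.dist_eq, Real.dist_eq]
  exact ⟨by simpa using hε, hu⟩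

lemma periodic_bound (h : ℝ → ℝ) (hc : Continuous h) (hp : Function.Periodic h (2*π)) :
    ∃ A, ∀ t, |h t| ≤ A := by
  obtain ⟨A, hA⟩ := (isCompact_Icc (a := (0:ℝ)) (b := 2*π)).exists_bound_of_continuousOn hc.continuousOn
  refine ⟨A, fun t => ?_⟩
  obtain ⟨y, hy, he⟩ := hp.exists_mem_Ico₀ (by positivity) t
  rw [he]; exact hA y (Ico_subset_Icc_self hy)

lemma small_eps (K η : ℝ) (hη : 0 < η) : ∀ᶠ ε in nhdsWithin (0:ℝ) (Ioi 0), ε * K < η := by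
  have : Filter.Tendsto (fun ε : ℝ => ε * K) (nhdsWithin 0 (Ioi 0)) (nhds (0 * K)) :=
    (Filter.tendsto_id.mono_left nhdsWithin_le_nhds).mul_const K
  exact this.eventually_lt_const (by simpa using hη)

lemma local_cycle (C0 C1 : ℝ → ℝ → ℝ → ℝ)
    (hc0 : Continuous (fun q : ℝ × ℝ × ℝ => C0 q.1 q.2.1 q.2.2))
    (hc1 : Continuous (fun q : ℝ × ℝ × ℝ => C1 q.1 q.2.1 q.2.2))
    (hder : ∀ s c u, HasDerivAt (C0 s c) (C1 s c u) u)
    (R δ0 : ℝ) (hδ0 : 0 < δ0)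
    (hzero : ∫ θ in (0:ℝ)..(2*π), 2 * R * cos θ * C0 (sin θ) (cos θ) R = 0)
    (hD0 : ∫ θ in (0:ℝ)..(2*π), 2 * cos θ * (C0 (sin θ) (cos θ) R + R * C1 (sin θ) (cos θ) R) ≠ 0) :
    ∃ δ, 0 < δ ∧ δ ≤ δ0 ∧ ∀ᶠ ε in nhdsWithin (0:ℝ) (Ioi 0),
      (∀ θ, ∀ u ∈ Icc (R-δ) (R+δ), |ε * C0 (sin θ) (cos θ) u| ≤ 1/2) ∧
      (∃ v : ℝ → ℝ, (∀ t, HasDerivAt v (polarField (fun s c u => ε * C0 s c u) t (v t)) t) ∧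
        Function.Periodic v (2*π) ∧ ∀ t, v t ∈ Ioo (R-δ) (R+δ)) ∧
      (∀ v₁ v₂ : ℝ → ℝ, ∀ k₁ k₂ : ℕ, 0 < k₁ → 0 < k₂ →
        (∀ t, HasDerivAt v₁ (polarField (fun s c u => ε * C0 s c u) t (v₁ t)) t) →
        (∀ t, HasDerivAt v₂ (polarField (fun s c u => ε * C0 s c u) t (v₂ t)) t) →
        (∀ t, v₁ t ∈ Ioo (R-δ) (R+δ)) → (∀ t, v₂ t ∈ Ioo (R-δ) (R+δ)) →
        Function.Periodic v₁ (k₁ * (2*π)) → Function.Periodic v₂ (k₂ * (2*π)) → v₁ = v₂) := by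
  let F : ℝ → ℝ → ℝ → ℝ → ℝ := fun ε s c u => 2 * u * c * C0 s c u / (1 - ε * (s * C0 s c u))
  let dF : ℝ → ℝ → ℝ → ℝ → ℝ := fun ε s c u =>
    (2 * c * (C0 s c u + u * C1 s c u) * (1 - ε * (s * C0 s c u))
      - 2 * u * c * C0 s c u * (-(ε * (s * C1 s c u)))) / (1 - ε * (s * C0 s c u))^2
  let h : ℝ → ℝ := fun θ => 2 * cos θ * (C0 (sin θ) (cos θ) R + R * C1 (sin θ) (cos θ) R)
  set D := ∫ θ in (0:ℝ)..(2*π), 2 * cos θ * (C0 (sin θ) (cos θ) R + R * C1 (sin θ) (cos θ) R) with hDdef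
  have hDpos : 0 < |D| := abs_pos.2 hD0
  have hcc0 : Continuous (fun q : (ℝ × ℝ) × (ℝ × ℝ) => C0 q.2.1 q.2.2 q.1.2) :=
    hc0.comp (g := fun q : ℝ × ℝ × ℝ => C0 q.1 q.2.1 q.2.2)
      (f := fun q : (ℝ × ℝ) × (ℝ × ℝ) => (q.2.1, q.2.2, q.1.2)) (by fun_prop)
  have hcc1 : Continuous (fun q : (ℝ × ℝ) × (ℝ × ℝ) => C1 q.2.1 q.2.2 q.1.2) :=
    hc1.comp (g := fun q : ℝ × ℝ × ℝ => C1 q.1 q.2.1 q.2.2)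
      (f := fun q : (ℝ × ℝ) × (ℝ × ℝ) => (q.2.1, q.2.2, q.1.2)) (by fun_prop)
  have hθ0 : ∀ u, Continuous (fun θ => C0 (sin θ) (cos θ) u) := fun u =>
    hc0.comp (g := fun q : ℝ × ℝ × ℝ => C0 q.1 q.2.1 q.2.2)
      (f := fun θ => (sin θ, cos θ, u)) (by fun_prop)
  have hθ1 : ∀ u, Continuous (fun θ => C1 (sin θ) (cos θ) u) := fun u =>
    hc1.comp (g := fun q : ℝ × ℝ × ℝ => C1 q.1 q.2.1 q.2.2)
      (f := fun θ => (sin θ, cos θ, u)) (by fun_prop)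
  have hhc : Continuous h := by
    have := hθ0 R
    have := hθ1 R
    fun_prop
  have hhp : Function.Periodic h (2*π) := fun θ => by
    simp only [h, sin_add_two_pi, cos_add_two_pi]
  have hF0c : Continuous (fun θ => F 0 (sin θ) (cos θ) R) := by
    have := hθ0 R
    simp only [F, zero_mul, sub_zero, div_one]
    fun_prop
  obtain ⟨A, hA⟩ := periodic_bound h hhc hhp
  obtain ⟨M, hM⟩ := periodic_bound _ hF0c (fun θ => by
    simp only [sin_add_two_pi, cos_add_two_pi])
  have hpi := pi_pos
  have hη : 0 < |D| / (16 * π) := by positivity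
  obtain ⟨d1, hd1, t1⟩ := tube R (fun ε s c u => ε * C0 s c u) (fun s c =>
    (continuous_fst.fst.mul hcc0).continuousAt) (1/2) (by norm_num)
  have hFc : ∀ s c, ContinuousAt (fun q : (ℝ × ℝ) × (ℝ × ℝ) => F q.1.1 q.2.1 q.2.2 q.1.2)
      ((0, R), (s, c)) := by
    intro s c
    refine ContinuousAt.div (by fun_prop) (by fun_prop) (by simp)
  have hdFc : ∀ s c, ContinuousAt (fun q : (ℝ × ℝ) × (ℝ × ℝ) => dF q.1.1 q.2.1 q.2.2 q.1.2)
      ((0, R), (s, c)) := by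
    intro s c
    refine ContinuousAt.div (by fun_prop) (by fun_prop) (by simp)
  obtain ⟨d2, hd2, t2⟩ := tube R F hFc 1 one_pos
  obtain ⟨d3, hd3, t3⟩ := tube R dF hdFc _ hη
  obtain ⟨δ, hδ, hδδ0, hδ1, hδ2, hδ3⟩ : ∃ δ > 0, δ ≤ δ0 ∧ δ < d1 ∧ δ < d2 ∧ δ < d3 := by
    refine ⟨min δ0 (min (d1/2) (min (d2/2) (d3/2))), by positivity, min_le_left _ _, ?_, ?_, ?_⟩
    · have : min δ0 (min (d1/2) (min (d2/2) (d3/2))) ≤ d1/2 :=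
        (min_le_right _ _).trans (min_le_left _ _)
      linarith
    · have : min δ0 (min (d1/2) (min (d2/2) (d3/2))) ≤ d2/2 :=
        (min_le_right _ _).trans ((min_le_right _ _).trans (min_le_left _ _))
      linarith
    · have : min δ0 (min (d1/2) (min (d2/2) (d3/2))) ≤ d3/2 :=
        (min_le_right _ _).trans ((min_le_right _ _).trans (min_le_right _ _))
      linarith
  have hη2 : 0 < |D| * δ / (16 * π) := by positivity
  obtain ⟨d4, hd4, t4⟩ := tube R F hFc _ hη2
  refine ⟨δ, hδ, hδδ0, ?_⟩
  filter_upwards [self_mem_nhdsWithin, small_eps 1 d1 hd1, small_eps 1 d2 hd2, small_eps 1 d3 hd3,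
    small_eps 1 d4 hd4, small_eps ((M+1) * (2*π)) (δ/2) (by positivity),
    small_eps (A * (M+1) * (2*π) * (2*π)) (|D| * δ / 8) (by positivity)] with
    ε hε e1 e2 e3 e4 e5 e6
  have hε : 0 < ε := hε
  have habs : |ε| = ε * 1 := by rw [abs_of_pos hε, mul_one]
  rw [← habs] at e1 e2 e3 e4
  have hIcc : ∀ u ∈ Icc (R-δ) (R+δ), |u - R| ≤ δ := fun u hu =>
    abs_le.2 ⟨by linarith [hu.1], by linarith [hu.2]⟩
  have c1 : ∀ θ, ∀ u ∈ Icc (R-δ) (R+δ), |ε * C0 (sin θ) (cos θ) u| ≤ 1/2 := by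
    intro θ u hu
    have := t1 ε u e1 ((hIcc u hu).trans_lt hδ1) θ
    simp only [zero_mul, sub_zero] at this
    exact this.le
  have hden : ∀ θ, ∀ u ∈ Icc (R-δ) (R+δ),
      0 < 1 - ε * (sin θ * C0 (sin θ) (cos θ) u) := by
    intro θ u hu
    have := abs_le.1 (abs_mul_le_half _ _ (abs_sin_le_one θ) (c1 θ u hu))
    have e : ε * (sin θ * C0 (sin θ) (cos θ) u) = sin θ * (ε * C0 (sin θ) (cos θ) u) := by ring
    rw [e]; linarith
  have hGF : ∀ θ u, polarField (fun s c u => ε * C0 s c u) θ u = ε * F ε (sin θ) (cos θ) u := by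
    intro θ u
    simp only [polarField, F]
    rw [← mul_div_assoc]
    congr 1 <;> ring
  have hFθ : ∀ u ∈ Icc (R-δ) (R+δ), Continuous (fun θ => F ε (sin θ) (cos θ) u) := by
    intro u hu
    have := hθ0 u
    exact Continuous.div (by fun_prop) (by fun_prop) (fun θ => (hden θ u hu).ne')
  have hFder : ∀ θ, ∀ u ∈ Icc (R-δ) (R+δ),
      HasDerivAt (fun u => F ε (sin θ) (cos θ) u) (dF ε (sin θ) (cos θ) u) u := by
    intro θ u hu
    have hC := hder (sin θ) (cos θ) u
    have n1 := ((((hasDerivAt_id u).const_mul 2).mul_const (cos θ)).mul hC)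
    have n2 := ((hC.const_mul (sin θ)).const_mul ε).const_sub 1
    refine (n1.div n2 (hden θ u hu).ne').congr_deriv ?_
    simp only [dF, id, Pi.mul_apply]
    congr 1
    ring
  have hdF0 : ∀ θ, dF 0 (sin θ) (cos θ) R = h θ := by
    intro θ; simp [dF, h]
  have hRm : R ∈ Icc (R-δ) (R+δ) := ⟨by linarith, by linarith⟩
  have hG : ∀ t, ∀ u ∈ Icc (R-δ) (R+δ), ∀ v ∈ Icc (R-δ) (R+δ),
      |polarField (fun s c u => ε * C0 s c u) t u - polarField (fun s c u => ε * C0 s c u) t v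
        - (ε * h t) * (u - v)| ≤ (ε * (|D| / (16*π))) * |u - v| := by
    intro t u hu v hv
    rw [hGF, hGF]
    have := (convex_Icc (R-δ) (R+δ)).norm_image_sub_le_of_norm_hasDerivWithin_le
      (f := fun u => ε * F ε (sin t) (cos t) u - ε * h t * u)
      (f' := fun u => ε * dF ε (sin t) (cos t) u - ε * h t * 1)
      (C := ε * (|D| / (16*π)))
      (fun x hx => (((hFder t x hx).const_mul ε).sub ((hasDerivAt_id x).const_mul _)).hasDerivWithinAt)
      (fun x hx => by
        have h3 := t3 ε x e3 ((hIcc x hx).trans_lt hδ3) t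
        rw [hdF0] at h3
        rw [mul_one, ← mul_sub, norm_mul, Real.norm_eq_abs, Real.norm_eq_abs, abs_of_pos hε]
        exact mul_le_mul_of_nonneg_left h3.le hε.le) hv hu
    rw [Real.norm_eq_abs, Real.norm_eq_abs] at this
    convert this using 2
    ring
  have hac : Continuous (fun t => ε * h t) := continuous_const.mul hhc
  have hap : Function.Periodic (fun t => ε * h t) (2*π) := fun t => by
    simp only [hhp t]
  have haint : ∫ x in (0:ℝ)..(2*π), ε * h x = ε * D := by
    rw [intervalIntegral.integral_const_mul]
  have haabs : |∫ x in (0:ℝ)..(2*π), ε * h x| = ε * |D| := by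
    rw [haint, abs_mul, abs_of_pos hε]
  refine ⟨c1, ?_, ?_⟩
  · refine periodic_exists _ R δ hδ (fun t => ε * h t) (ε * (|D| / (16*π))) (ε * A) (ε * (M+1))
      (ε * (|D| * δ / (16 * π) * (2*π))) hac ?_ (by positivity) ?_ ?_ ?_ (by linarith) hG ?_ ?_
    · intro t
      rw [abs_mul, abs_of_pos hε]
      exact mul_le_mul_of_nonneg_left (hA t) hε.le
    · intro u t
      simp only [polarField, sin_add_two_pi, cos_add_two_pi]
    · intro u hu
      simp only [hGF]
      exact continuous_const.mul (hFθ u hu)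
    · intro t u hu
      rw [hGF, abs_mul, abs_of_pos hε]
      refine mul_le_mul_of_nonneg_left ?_ hε.le
      have h2 := t2 ε u e2 ((hIcc u hu).trans_lt hδ2) t
      have h3 := hM t
      have h4 := abs_sub_abs_le_abs_sub (F ε (sin t) (cos t) u) (F 0 (sin t) (cos t) R)
      linarith
    · simp only [hGF]
      rw [intervalIntegral.integral_const_mul, abs_mul, abs_of_pos hε]
      refine mul_le_mul_of_nonneg_left ?_ hε.le
      have z : ∫ θ in (0:ℝ)..(2*π), F 0 (sin θ) (cos θ) R = 0 := by
        simpa only [F, zero_mul, sub_zero, div_one] using hzero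
      have e : ∫ θ in (0:ℝ)..(2*π), F ε (sin θ) (cos θ) R
          = ∫ θ in (0:ℝ)..(2*π), (F ε (sin θ) (cos θ) R - F 0 (sin θ) (cos θ) R) := by
        rw [intervalIntegral.integral_sub ((hFθ R hRm).intervalIntegrable _ _)
          (hF0c.intervalIntegrable _ _), z, sub_zero]
      rw [e]
      have := intervalIntegral.norm_integral_le_of_norm_le_const (a := 0) (b := 2*π)
        (f := fun θ => F ε (sin θ) (cos θ) R - F 0 (sin θ) (cos θ) R) (C := |D| * δ / (16 * π))
        (fun θ _ => (t4 ε R e4 (by simpa using hd4) θ).le)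
      rw [sub_zero, abs_of_pos (by positivity : (0:ℝ) < 2*π)] at this
      exact this
    · rw [haabs]
      have q1 : ε * (|D| * δ / (16 * π) * (2*π)) = ε * (|D| * δ / 8) := by
        field_simp; ring
      have q2 : (ε * (|D| / (16*π)) * δ + ε * A * (ε * (M+1) * (2*π))) * (2*π)
          = ε * (|D| * δ / 8) + ε * (ε * (A * (M+1) * (2*π) * (2*π))) := by
        field_simp; ring
      rw [q1, q2]
      have q3 := mul_lt_mul_of_pos_left e6 hε
      have q4 : 0 < ε * (|D| * δ) := by positivity
      nlinarith
  · intro v₁ v₂ k₁ k₂ hk₁ hk₂ s₁ s₂ m₁ m₂ p₁ p₂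
    refine periodic_unique _ (Icc (R-δ) (R+δ)) (fun t => ε * h t) (ε * (|D| / (16*π))) hac hap ?_ hG
      v₁ v₂ s₁ s₂ (fun t => Ioo_subset_Icc_self (m₁ t)) (fun t => Ioo_subset_Icc_self (m₂ t))
      k₁ k₂ hk₁ hk₂ p₁ p₂
    rw [haabs]
    have q1 : ε * (|D| / (16 * π)) * (2*π) = ε * |D| / 8 := by
      field_simp; ring
    rw [q1]
    have : 0 < ε * |D| := by positivity
    linarith

theorem wallis_pos (n k : ℕ) :
    0 < ∫ θ in (0:ℝ)..(2*π), sin θ ^ (2*n) * cos θ ^ (2*k+2) := by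
  have hpi := Real.pi_pos
  refine intervalIntegral.integral_pos (by positivity) (by fun_prop) ?_ ?_
  · intro x _
    have h1 : 0 ≤ sin x ^ (2*n) := by rw [pow_mul]; positivity
    have h2 : 0 ≤ cos x ^ (2*k+2) := by
      rw [show 2*k+2 = 2*(k+1) by ring, pow_mul]; positivity
    positivity
  · refine ⟨π/4, ⟨by positivity, by linarith⟩, ?_⟩
    rw [Real.sin_pi_div_four, Real.cos_pi_div_four]
    positivity

theorem core_cycles (N : ℕ) (n k : Fin (N+1) → ℕ)
    (hinj : Function.Injective (fun j => n j + k j + 1)) :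
    ∃ a : Fin (N+1) → ℝ,
      HasAtLeastNLimitCycles
        (fun p : ℝ × ℝ =>
          ((p.2, -p.1 + ∑ j, a j * p.1 ^ (2 * n j) * p.2 ^ (2 * k j + 1)) : ℝ × ℝ)) N := by
  obtain ⟨β, hβ⟩ := roots_exist N _ hinj
  set W : Fin (N+1) → ℝ :=
    fun j => ∫ θ in (0:ℝ)..(2*π), sin θ ^ (2*n j) * cos θ ^ (2*k j+2) with hW
  have hWpos : ∀ j, 0 < W j := fun j => wallis_pos _ _
  set b : Fin (N+1) → ℝ := fun j => β j / (2 * W j) with hb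
  have hbW : ∀ j, 2 * (b j * W j) = β j := by
    intro j
    have := (hWpos j).ne'
    simp only [hb]
    field_simp
  set C0 : ℝ → ℝ → ℝ → ℝ :=
    fun s c u => ∑ j, b j * u ^ (n j + k j) * s ^ (2*n j) * c ^ (2*k j+1) with hC0
  set C1 : ℝ → ℝ → ℝ → ℝ :=
    fun s c u => ∑ j, b j * (((n j + k j : ℕ) : ℝ) * u ^ (n j + k j - 1)) * s ^ (2*n j)
      * c ^ (2*k j+1) with hC1
  have hc0 : Continuous fun q : ℝ × ℝ × ℝ => C0 q.1 q.2.1 q.2.2 := by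
    simp only [hC0]; fun_prop
  have hc1 : Continuous fun q : ℝ × ℝ × ℝ => C1 q.1 q.2.1 q.2.2 := by
    simp only [hC1]; fun_prop
  have hder : ∀ s c u, HasDerivAt (C0 s c) (C1 s c u) u := by
    intro s c u
    simp only [hC0, hC1]
    refine HasDerivAt.fun_sum fun j _ => ?_
    exact (((hasDerivAt_pow (n j + k j) u).const_mul (b j)).mul_const _).mul_const _
  -- averaged integrals
  have hIntegral : ∀ γ : Fin (N+1) → ℝ,
      ∫ θ in (0:ℝ)..(2*π), ∑ j, γ j * (sin θ ^ (2*n j) * cos θ ^ (2*k j+2))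
        = ∑ j, γ j * W j := by
    intro γ
    rw [intervalIntegral.integral_finsetSum]
    · simp only [intervalIntegral.integral_const_mul, hW]
    · intro j _
      apply Continuous.intervalIntegrable
      fun_prop
  have hzero : ∀ i : Fin N, ∫ θ in (0:ℝ)..(2*π),
      2*((i:ℝ)+1)*cos θ*C0 (sin θ) (cos θ) ((i:ℝ)+1) = 0 := by
    intro i
    refine Eq.trans ?_ (hβ i).1
    have h1 : ∀ θ : ℝ, 2*((i:ℝ)+1)*cos θ*C0 (sin θ) (cos θ) ((i:ℝ)+1)
        = ∑ j, (2 * b j * ((i:ℝ)+1)^(n j + k j + 1)) * (sin θ ^ (2*n j) * cos θ ^ (2*k j+2)) := by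
      intro θ
      simp only [hC0, Finset.mul_sum]
      refine Finset.sum_congr rfl fun j _ => ?_
      ring
    simp only [h1]
    rw [hIntegral]
    refine Finset.sum_congr rfl fun j _ => ?_
    rw [← hbW j]; ring
  have hD0 : ∀ i : Fin N, ∫ θ in (0:ℝ)..(2*π),
      2*cos θ*(C0 (sin θ) (cos θ) ((i:ℝ)+1) + ((i:ℝ)+1)*C1 (sin θ) (cos θ) ((i:ℝ)+1)) ≠ 0 := by
    intro i
    have h1 : ∀ θ : ℝ, 2*cos θ*(C0 (sin θ) (cos θ) ((i:ℝ)+1)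
          + ((i:ℝ)+1)*C1 (sin θ) (cos θ) ((i:ℝ)+1))
        = ∑ j, (2 * b j * (((n j + k j + 1 : ℕ) : ℝ) * ((i:ℝ)+1)^(n j + k j)))
            * (sin θ ^ (2*n j) * cos θ ^ (2*k j+2)) := by
      intro θ
      simp only [hC0, hC1, Finset.mul_sum, ← Finset.sum_add_distrib]
      refine Finset.sum_congr rfl fun j _ => ?_
      have h2 : ((n j + k j : ℕ) : ℝ) * ((i:ℝ)+1)^(n j + k j)
          = ((i:ℝ)+1) * (((n j + k j : ℕ) : ℝ) * ((i:ℝ)+1)^(n j + k j - 1)) := by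
        rcases Nat.eq_zero_or_pos (n j + k j) with h | h
        · rw [h]; simp
        · obtain ⟨d, hd⟩ := Nat.exists_eq_succ_of_ne_zero h.ne'
          rw [hd]; simp only [Nat.succ_eq_add_one, Nat.add_sub_cancel]; ring
      rw [Nat.cast_add_one, add_mul ((n j + k j : ℕ) : ℝ) 1, h2]
      ring
    simp only [h1]
    rw [hIntegral]
    intro h
    apply (hβ i).2
    rw [← h]
    refine Finset.sum_congr rfl fun j _ => ?_
    rw [← hbW j, Nat.add_sub_cancel]; ring
  have hloc := fun i : Fin N =>
    local_cycle C0 C1 hc0 hc1 hder ((i:ℝ)+1) (1/4) (by norm_num) (hzero i) (hD0 i)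
  choose δ hδpos hδle hev using hloc
  obtain ⟨ε, hε⟩ := (Filter.eventually_all.2 hev).exists
  choose hbd hex huniq using hε
  choose v hv hvper hvmem using hex
  have hRpos : ∀ i : Fin N, ∀ u ∈ Ioo ((i:ℝ)+1 - δ i) ((i:ℝ)+1 + δ i), 0 < u := by
    intro i u hu
    have := hδle i
    have h0 : (0:ℝ) ≤ (i:ℝ) := Nat.cast_nonneg _
    linarith [hu.1]
  refine ⟨fun j => ε * b j, ?_⟩
  set g : ℝ → ℝ → ℝ := fun x y => ∑ j, ε * b j * x ^ (2 * n j) * y ^ (2 * k j + 1) with hgdef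
  have hgc : Continuous fun p : ℝ × ℝ => g p.1 p.2 := by
    simp only [hgdef]; fun_prop
  have hg : ∀ u > 0, ∀ s c, g (√u*s) (√u*c) = √u * (ε * C0 s c u) := by
    intro u hu s c
    simp only [hgdef, hC0, Finset.mul_sum]
    refine Finset.sum_congr rfl fun j _ => ?_
    have h : u ^ (n j + k j) = √u ^ (2 * (n j + k j)) := by
      rw [pow_mul, Real.sq_sqrt hu.le]
    rw [h]; ring
  have hCc : Continuous fun q : ℝ × ℝ × ℝ => ε * C0 q.1 q.2.1 q.2.2 :=
    continuous_const.mul hc0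
  have hb1 := fun i => bridge1 g (fun s c u => ε * C0 s c u) hCc hg (v i)
    (fun θ => hRpos i _ (hvmem i θ)) (hvper i)
    (fun θ => hbd i θ _ (Ioo_subset_Icc_self (hvmem i θ))) (hv i)
  choose φ hφ hrange using hb1
  have hnorm : ∀ i θ, (√(v i θ) * sin θ)^2 + (√(v i θ) * cos θ)^2 = v i θ := by
    intro i θ
    have h1 := Real.sq_sqrt (hRpos i _ (hvmem i θ)).le
    have h2 := Real.sin_sq_add_cos_sq θ
    calc _ = (√(v i θ))^2 * (sin θ^2 + cos θ^2) := by ring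
      _ = _ := by rw [h1, h2, mul_one]
  have hsub : ∀ i, ∀ p ∈ range (φ i),
      p.1^2 + p.2^2 ∈ Ioo ((i:ℝ)+1 - δ i) ((i:ℝ)+1 + δ i) := by
    intro i p hp
    rw [hrange i] at hp
    obtain ⟨θ, rfl⟩ := hp
    simp only [hnorm]
    exact hvmem i θ
  refine ⟨φ, fun i => ⟨hφ i, {p | p.1^2 + p.2^2 ∈ Ioo ((i:ℝ)+1 - δ i) ((i:ℝ)+1 + δ i)},
    isOpen_Ioo.preimage (by fun_prop), fun p hp => hsub i p hp, ?_⟩, ?_⟩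
  · intro ψ hψ hψU
    obtain ⟨w, hwI, hw, ⟨q, hq, hwper⟩, hwr⟩ := bridge2 g (fun s c u => ε * C0 s c u)
      (Ioo ((i:ℝ)+1 - δ i) ((i:ℝ)+1 + δ i)) (hRpos i) hgc hg
      (fun θ u hu => hbd i θ u (Ioo_subset_Icc_self hu)) ψ hψ (fun t => hψU ⟨t, rfl⟩)
    have heq : w = v i := huniq i w (v i) q 1 hq one_pos hw (hv i) hwI (hvmem i) hwper
      (by simpa using hvper i)
    rw [hwr, hrange i, heq]
  · intro i j hij h
    have h1 := hsub i (φ i 0) ⟨0, rfl⟩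
    have h2 := hsub j (φ i 0) (h ▸ ⟨0, rfl⟩)
    have hi := hδle i
    have hj := hδle j
    rcases lt_or_gt_of_ne (fun h => hij (Fin.ext h) : (i:ℕ) ≠ (j:ℕ)) with hlt | hlt
    · have : (i:ℝ) + 1 ≤ (j:ℝ) := by exact_mod_cast hlt
      linarith [h1.2, h2.1]
    · have : (j:ℝ) + 1 ≤ (i:ℝ) := by exact_mod_cast hlt
      linarith [h1.1, h2.2]

/-- Let `m ≥ 4` and let `(n_0,k_0), …, (n_{m-3},k_{m-3}) ∈ ℕ₀²` be such
that the numbers `2(n_j + k_j)` are pairwise distinct. Then there exist real coefficients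
`a_0, …, a_{m-3}` such that the system
`(ẋ,ẏ) = (y, -x + ∑_{j=0}^{m-3} a_j x^{2n_j} y^{2k_j+1})` has at least `m - 3` limit
cycles. -/
theorem statement12 (m : ℕ) (hm : 4 ≤ m) (nk : Fin (m - 2) → ℕ × ℕ)
    (hdist : Function.Injective (fun j : Fin (m - 2) => 2 * ((nk j).1 + (nk j).2))) :
    ∃ a : Fin (m - 2) → ℝ,
      HasAtLeastNLimitCycles
        (fun p : ℝ × ℝ =>
          ((p.2, -p.1 + ∑ j : Fin (m - 2),
              a j * p.1 ^ (2 * (nk j).1) * p.2 ^ (2 * (nk j).2 + 1)) : ℝ × ℝ))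
        (m - 3) := by
  obtain ⟨N, rfl⟩ : ∃ N, m = N + 3 := ⟨m - 3, by omega⟩
  exact core_cycles N (fun j => (nk j).1) (fun j => (nk j).2) (fun i j h => hdist (by
    simp only at h ⊢
    omega))
end
end

section
/- Consider the system of differential equations x'(t) = ε H(t,x) + ε² K(t,x,ε), where H : ℝ × D → ℝⁿ and K : ℝ × D × (-ε₀, ε₀) → ℝⁿ are continuous functions, T-periodic in the first variable, D is an open subset of ℝⁿ, and ε₀ > 0. Define the averaged function h : D → ℝⁿ by h(z) = (1/T) ∫_0^T H(t,z) dt. Suppose h is of class C¹ and there is a ∈ D with h(a) = 0 and det(Dh(a)) ≠ 0. Then for each |ε| > 0 small enough there is a T-periodic solution φ(·, ε) of the system such that φ(·, ε) → a as ε → 0. -/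
open Set

noncomputable section

lemma det_interp_aux {E : Type*} [NormedAddCommGroup E] [NormedSpace ℝ E] [FiniteDimensional ℝ E]
    (τ : ℝ) (hτ : 0 < τ) : ∃ (s : Finset ℕ) (c v : ℕ → ℝ), (∀ i ∈ s, 0 < v i ∧ v i < τ) ∧
      ∑ i ∈ s, c i = 1 ∧ ∀ L : E →L[ℝ] E,
        (ContinuousLinearMap.id ℝ E + L).det =
          ∑ i ∈ s, c i * (ContinuousLinearMap.id ℝ E + v i • L).det := by
  classical
  set d := Module.finrank ℝ E with hd
  let s := Finset.range (d + 1)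
  let v : ℕ → ℝ := fun i => τ / (i + 2)
  have hv : Set.InjOn v s := by
    intro i _ j _ hij
    have hij : τ / ((i : ℝ) + 2) = τ / ((j : ℝ) + 2) := hij
    have h1 : ((i : ℝ) + 2) ≠ 0 := by positivity
    have h2 : ((j : ℝ) + 2) ≠ 0 := by positivity
    rw [div_eq_div_iff h1 h2] at hij
    have := mul_left_cancel₀ hτ.ne' hij
    have h3 : (i : ℝ) = j := by linarith
    exact_mod_cast h3
  have hs : s.Nonempty := ⟨0, by simp [s]⟩
  refine ⟨s, fun i => (Lagrange.basis s v i).eval 1, v, ?_, ?_, ?_⟩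
  · intro i _
    constructor
    · simp only [v]; positivity
    · simp only [v]
      rw [div_lt_iff₀ (by positivity)]
      nlinarith [(Nat.cast_nonneg i : (0:ℝ) ≤ i)]
  · rw [← Polynomial.eval_finsetSum, Lagrange.sum_basis hv hs]; simp
  · intro L
    let b := Module.finBasis ℝ E
    let M := LinearMap.toMatrix b b (L : E →ₗ[ℝ] E)
    let p : Polynomial ℝ := Matrix.det ((Polynomial.X : Polynomial ℝ) • M.map Polynomial.C
      + (1 : Matrix (Fin d) (Fin d) ℝ).map Polynomial.C)
    have hp : ∀ t : ℝ, p.eval t = (ContinuousLinearMap.id ℝ E + t • L).det := by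
      intro t
      have h1 : (ContinuousLinearMap.id ℝ E + t • L).det = Matrix.det (1 + t • M) := by
        rw [ContinuousLinearMap.det, ← LinearMap.det_toMatrix b]
        congr 1
        simp [M]
      rw [h1, add_comm]
      simp only [p]
      rw [← Polynomial.coe_evalRingHom, RingHom.map_det]
      congr 1
      ext i j
      by_cases hij : i = j
      · subst hij
        simp [Matrix.map_apply]
        ring
      · simp [Matrix.map_apply, Matrix.one_apply_ne hij]
        ring
    have hdeg : p.degree < s.card := by
      have h1 : p.natDegree ≤ d := by
        exact (Polynomial.natDegree_det_X_add_C_le M 1).trans (by simp [d])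
      have : p.natDegree < s.card := by simp [s]; omega
      exact lt_of_le_of_lt Polynomial.degree_le_natDegree (by exact_mod_cast this)
    have h2 := Lagrange.eq_interpolate hv hdeg
    have h3 := congrArg (Polynomial.eval 1) h2
    rw [hp, Lagrange.interpolate_apply, Polynomial.eval_finsetSum] at h3
    rw [one_smul] at h3
    rw [h3]
    refine Finset.sum_congr rfl fun i _ => ?_
    simp [hp, mul_comm]

lemma radial_lip_aux {E : Type*} [NormedAddCommGroup E] [NormedSpace ℝ E] (x y : E) :
    ‖(max 1 ‖x‖)⁻¹ • x - (max 1 ‖y‖)⁻¹ • y‖ ≤ 2 * ‖x - y‖ := by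
  set a := max 1 ‖x‖ with ha
  set b := max 1 ‖y‖ with hb
  have ha1 : 1 ≤ a := le_max_left _ _
  have hb1 : 1 ≤ b := le_max_left _ _
  have hy : ‖y‖ ≤ b := le_max_right _ _
  have hab : |b - a| ≤ ‖x - y‖ := by
    have h1 := abs_max_sub_max_le_max 1 ‖y‖ 1 ‖x‖
    have h2 := abs_norm_sub_norm_le y x
    rw [norm_sub_rev] at h2
    simp at h1
    linarith
  have e : a⁻¹ • x - b⁻¹ • y = a⁻¹ • (x - y) + (a⁻¹ - b⁻¹) • y := by
    rw [smul_sub, sub_smul]; abel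
  have h1 : ‖a⁻¹ • (x - y)‖ ≤ ‖x - y‖ := by
    rw [norm_smul, norm_inv, Real.norm_of_nonneg (by linarith)]
    exact mul_le_of_le_one_left (norm_nonneg _) (inv_le_one_of_one_le₀ ha1)
  have h2 : ‖(a⁻¹ - b⁻¹) • y‖ ≤ ‖x - y‖ := by
    have : a⁻¹ - b⁻¹ = a⁻¹ * ((b - a) * b⁻¹) := by
      field_simp
    rw [norm_smul, this, norm_mul, norm_mul, norm_inv, norm_inv, Real.norm_of_nonneg (by linarith : 0 ≤ a),
      Real.norm_of_nonneg (by linarith : 0 ≤ b), Real.norm_eq_abs]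
    have h3 : a⁻¹ ≤ 1 := inv_le_one_of_one_le₀ ha1
    have h4 : b⁻¹ * ‖y‖ ≤ 1 := by
      rw [inv_mul_le_iff₀ (by linarith)]; linarith
    calc a⁻¹ * (|b - a| * b⁻¹) * ‖y‖ = a⁻¹ * (|b - a| * (b⁻¹ * ‖y‖)) := by ring
      _ ≤ 1 * (|b - a| * 1) := by gcongr
      _ ≤ _ := by linarith
  rw [e]
  linarith [norm_add_le (a⁻¹ • (x - y)) ((a⁻¹ - b⁻¹) • y)]

lemma image_ball_aux {E : Type*} [NormedAddCommGroup E] [NormedSpace ℝ E] [CompleteSpace E]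
    (g : E → E) (C t : ℝ) (ht : 0 ≤ t) (ht1 : t ≤ 1) (hC : t * C ≤ 1 / 4)
    (hg : ∀ x ∈ Metric.closedBall (0 : E) 1, ∀ y ∈ Metric.closedBall (0 : E) 1,
      ‖g x - g y‖ ≤ C * ‖x - y‖)
    (hg0 : ∀ x, ‖x‖ = 1 → g x = 0)
    (hgB : ∀ x ∈ Metric.closedBall (0 : E) 1, ‖x + g x‖ ≤ 1) :
    InjOn (fun x => x + t • g x) (Metric.closedBall (0 : E) 1) ∧
      (fun x => x + t • g x) '' Metric.closedBall (0 : E) 1 = Metric.closedBall (0 : E) 1 := by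
  constructor
  · intro x hx y hy hxy
    have hxy : x + t • g x = y + t • g y := hxy
    have h1 : x - y = t • (g y - g x) := by
      rw [smul_sub, sub_eq_sub_iff_add_eq_add, hxy, add_comm]
    have h2 : ‖x - y‖ ≤ 1 / 4 * ‖x - y‖ := by
      calc ‖x - y‖ = t * ‖g y - g x‖ := by
            rw [h1, norm_smul, Real.norm_of_nonneg ht]
        _ ≤ t * (C * ‖x - y‖) := by
            rw [norm_sub_rev x y]
            exact mul_le_mul_of_nonneg_left (hg y hy x hx) ht
        _ = (t * C) * ‖x - y‖ := by ring
        _ ≤ _ := by gcongr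
    have h3 : ‖x - y‖ = 0 := by linarith [norm_nonneg (x - y)]
    exact sub_eq_zero.1 (norm_eq_zero.1 h3)
  · apply Subset.antisymm
    · rintro _ ⟨x, hx, rfl⟩
      have hxn : ‖x‖ ≤ 1 := by simpa using hx
      have h1 := hgB x hx
      have : x + t • g x = (1 - t) • x + t • (x + g x) := by
        rw [sub_smul, smul_add, one_smul]; abel
      simp only [mem_closedBall_zero_iff]
      rw [this]
      refine (norm_add_le _ _).trans ?_
      rw [norm_smul, norm_smul, Real.norm_of_nonneg ht, Real.norm_of_nonneg (by linarith)]
      nlinarith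
    · intro y hy
      let ρ : E → E := fun x => (max 1 ‖x‖)⁻¹ • x
      have hρ : ∀ x, ρ x ∈ Metric.closedBall (0 : E) 1 := by
        intro x
        simp only [ρ, mem_closedBall_zero_iff]
        rw [norm_smul, norm_inv, Real.norm_of_nonneg (by positivity), inv_mul_le_iff₀ (by positivity)]
        simp
      have hcon : ContractingWith (1 / 2) (fun x => y - t • g (ρ x)) := by
        refine ⟨by rw [← NNReal.coe_lt_coe]; norm_num, LipschitzWith.of_dist_le_mul fun x z => ?_⟩
        rw [dist_eq_norm, dist_eq_norm]
        have : y - t • g (ρ x) - (y - t • g (ρ z)) = t • (g (ρ z) - g (ρ x)) := by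
          rw [smul_sub]; abel
        rw [this, norm_smul, Real.norm_of_nonneg ht]
        have h1 := hg _ (hρ z) _ (hρ x)
        have h2 := radial_lip_aux z x
        have h3 : t * ‖g (ρ z) - g (ρ x)‖ ≤ (t * C) * ‖ρ z - ρ x‖ := by
          rw [mul_assoc]; exact mul_le_mul_of_nonneg_left h1 ht
        have h4 : (t * C) * ‖ρ z - ρ x‖ ≤ 1 / 4 * (2 * ‖z - x‖) := by
          gcongr
        rw [norm_sub_rev x z]
        push_cast
        linarith
      set x := ContractingWith.fixedPoint _ hcon with hx
      have hfix : y - t • g (ρ x) = x := hcon.fixedPoint_isFixedPt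
      by_cases hxn : ‖x‖ ≤ 1
      · have hρx : ρ x = x := by simp [ρ, max_eq_left hxn]
        rw [hρx] at hfix
        refine ⟨x, by simpa using hxn, ?_⟩
        simp only
        rw [← eq_sub_iff_add_eq.1 hfix.symm]
      · push Not at hxn
        have hρx : ‖ρ x‖ = 1 := by
          simp only [ρ]
          rw [max_eq_right hxn.le, norm_smul, norm_inv, norm_norm]
          exact inv_mul_cancel₀ (by linarith)
        rw [hg0 _ hρx, smul_zero, sub_zero] at hfix
        rw [hfix] at hy
        simp at hy
        linarith

open MeasureTheory in
lemma no_retract_aux {E : Type*} [NormedAddCommGroup E] [InnerProductSpace ℝ E]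
    [FiniteDimensional ℝ E] (r : E → E) (U : Set E) (hU : IsOpen U)
    (hBU : Metric.closedBall (0 : E) 1 ⊆ U) (hr : ContDiffOn ℝ 1 r U)
    (hr1 : ∀ x ∈ Metric.closedBall (0 : E) 1, ‖r x‖ = 1)
    (hr2 : ∀ x, ‖x‖ = 1 → r x = x) : False := by
  borelize E
  let B := Metric.closedBall (0 : E) 1
  have hBc : IsCompact B := isCompact_closedBall _ _
  let μ : Measure E := Measure.addHaar
  let g : E → E := fun x => r x - x
  have hgC : ContDiffOn ℝ 1 g U := hr.sub contDiffOn_id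
  have hgd : ∀ x ∈ U, DifferentiableAt ℝ g x := fun x hx =>
    (hgC.differentiableOn one_ne_zero).differentiableAt (hU.mem_nhds hx)
  let g' := fderiv ℝ g
  have hg'c : ContinuousOn g' B :=
    (hgC.continuousOn_fderiv_of_isOpen hU le_rfl).mono hBU
  obtain ⟨C, hC⟩ := hBc.exists_bound_of_continuousOn hg'c
  have hC0 : 0 ≤ C := (norm_nonneg _).trans (hC 0 (by simp [B]))
  have hlip : ∀ x ∈ B, ∀ y ∈ B, ‖g x - g y‖ ≤ C * ‖x - y‖ := by
    intro x hx y hy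
    exact (convex_closedBall (0:E) 1).norm_image_sub_le_of_norm_fderiv_le
      (fun z hz => hgd z (hBU hz)) hC hy hx
  have hdet1 : ∃ ρ > 0, ∀ L : E →L[ℝ] E, ‖L‖ < ρ → 0 < (ContinuousLinearMap.id ℝ E + L).det := by
    have hc : Continuous fun L : E →L[ℝ] E => (ContinuousLinearMap.id ℝ E + L).det :=
      ContinuousLinearMap.continuous_det.comp (by fun_prop)
    have h0 : 0 < (ContinuousLinearMap.id ℝ E + (0 : E →L[ℝ] E)).det := by
      simp [ContinuousLinearMap.det]
    have := hc.continuousAt.eventually (lt_mem_nhds h0)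
    obtain ⟨ρ, hρ, h⟩ := Metric.eventually_nhds_iff.1 this
    exact ⟨ρ, hρ, fun L hL => h (by simpa using hL)⟩
  obtain ⟨ρ, hρ, hdet⟩ := hdet1
  let τ := min 1 (min (1 / (4 * (C + 1))) (ρ / (C + 1)))
  have hτ : 0 < τ := by positivity
  obtain ⟨s, c, v, hv, hc, hL⟩ := det_interp_aux (E := E) τ hτ
  have hint : ∀ t : ℝ, IntegrableOn (fun x => (ContinuousLinearMap.id ℝ E + t • g' x).det) B μ := by
    intro t
    apply ContinuousOn.integrableOn_compact hBc
    exact ContinuousLinearMap.continuous_det.comp_continuousOn (by fun_prop)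
  have hvol : ∀ t, 0 < t → t < τ →
      ∫ x in B, (ContinuousLinearMap.id ℝ E + t • g' x).det ∂μ = (μ B).toReal := by
    intro t ht htτ
    have ht1 : t ≤ 1 := htτ.le.trans (min_le_left _ _)
    have ht2 : t ≤ 1 / (4 * (C + 1)) := htτ.le.trans ((min_le_right _ _).trans (min_le_left _ _))
    have ht3 : t < ρ / (C + 1) := lt_of_lt_of_le htτ ((min_le_right _ _).trans (min_le_right _ _))
    have hC1 : 0 < C + 1 := by linarith
    rw [le_div_iff₀ (by positivity)] at ht2
    rw [lt_div_iff₀ (by positivity)] at ht3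
    obtain ⟨hinj, him⟩ := image_ball_aux g C t ht.le ht1 (by nlinarith) hlip
      (fun x hx => by simp [g, hr2 x hx])
      (fun x hx => by simp [g, hr1 x hx])
    have hcv := integral_image_eq_integral_abs_det_fderiv_smul μ (s := B)
      (f := fun x => x + t • g x) (f' := fun x => ContinuousLinearMap.id ℝ E + t • g' x)
      Metric.isClosed_closedBall.measurableSet
      (fun x hx => ((hasFDerivAt_id x).add
        ((hgd x (hBU hx)).hasFDerivAt.const_smul t)).hasFDerivWithinAt) hinj (fun _ => (1 : ℝ))
    rw [him] at hcv
    simp only [smul_eq_mul, mul_one, integral_const] at hcv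
    rw [setIntegral_congr_fun (g := fun x => |(ContinuousLinearMap.id ℝ E + t • g' x).det|)
      Metric.isClosed_closedBall.measurableSet, ← hcv]
    · simp [B, Measure.real]
    · intro x hx
      simp only
      rw [abs_of_pos]
      apply hdet
      rw [norm_smul, Real.norm_of_nonneg ht.le]
      have := hC x hx
      nlinarith
  have h1 : ∫ x in B, (ContinuousLinearMap.id ℝ E + g' x).det ∂μ = (μ B).toReal := by
    rw [show (fun x => (ContinuousLinearMap.id ℝ E + g' x).det) = fun x =>
      ∑ i ∈ s, c i * (ContinuousLinearMap.id ℝ E + v i • g' x).det from funext fun x => hL _]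
    rw [integral_finsetSum _ (fun i _ => (hint (v i)).const_mul (c i))]
    rw [Finset.sum_congr rfl (g := fun i => c i * (μ B).toReal), ← Finset.sum_mul, hc, one_mul]
    intro i hi
    rw [integral_const_mul, hvol _ (hv i hi).1 (hv i hi).2]
  have hpos : 0 < (μ B).toReal := by
    refine ENNReal.toReal_pos ?_ hBc.measure_lt_top.ne
    exact (Metric.measure_closedBall_pos μ 0 one_pos).ne'
  have h2 : ∫ x in B, (ContinuousLinearMap.id ℝ E + g' x).det ∂μ = 0 := by
    rw [setIntegral_congr_set (t := Metric.ball (0 : E) 1)]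
    · apply setIntegral_eq_zero_of_forall_eq_zero
      intro x hx
      have hxB : x ∈ B := Metric.ball_subset_closedBall hx
      have hrd : DifferentiableAt ℝ r x :=
        (hr.differentiableOn one_ne_zero).differentiableAt (hU.mem_nhds (hBU hxB))
      have he : ContinuousLinearMap.id ℝ E + g' x = fderiv ℝ r x := by
        have : g' x = fderiv ℝ r x - ContinuousLinearMap.id ℝ E :=
          (hrd.hasFDerivAt.sub (hasFDerivAt_id x)).fderiv
        rw [this]; abel
      rw [he]
      have hort : ∀ w, inner ℝ (r x) (fderiv ℝ r x w) = 0 := by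
        intro w
        have h3 := (hrd.hasFDerivAt.inner ℝ hrd.hasFDerivAt)
        have h4 : (fun y => inner ℝ (r y) (r y)) =ᶠ[nhds x] fun _ => (1 : ℝ) := by
          filter_upwards [Metric.isOpen_ball.mem_nhds hx] with y hy
          rw [real_inner_self_eq_norm_sq, hr1 y (Metric.ball_subset_closedBall hy)]; simp
        have h5 : HasFDerivAt (fun y => inner ℝ (r y) (r y)) (0 : E →L[ℝ] ℝ) x := (hasFDerivAt_const (1 : ℝ) x).congr_of_eventuallyEq h4
        have h6 := DFunLike.congr_fun (h3.unique h5) w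
        simp [fderivInnerCLM_apply] at h6
        rw [real_inner_comm (r x)] at h6
        rw [real_inner_comm] at h6 ⊢
        linarith
      by_contra hne
      have hunit : IsUnit (LinearMap.det (fderiv ℝ r x : E →ₗ[ℝ] E)) := isUnit_iff_ne_zero.2 hne
      have hsurj := (LinearEquiv.ofIsUnitDet (v := Module.finBasis ℝ E) (v' := Module.finBasis ℝ E)
        (f := (fderiv ℝ r x : E →ₗ[ℝ] E)) (by rw [LinearMap.det_toMatrix]; exact hunit)).surjective
      obtain ⟨w, hw⟩ := hsurj (r x)
      have hw : fderiv ℝ r x w = r x := hw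
      have := hort w
      rw [hw, real_inner_self_eq_norm_sq, hr1 x hxB] at this
      norm_num at this
    · refine (ae_eq_of_subset_of_measure_ge Metric.ball_subset_closedBall ?_
        measurableSet_ball.nullMeasurableSet hBc.measure_lt_top.ne).symm
      have : Metric.closedBall (0 : E) 1 = Metric.ball 0 1 ∪ Metric.sphere 0 1 :=
        Metric.ball_union_sphere.symm
      rw [this]
      refine (measure_union_le _ _).trans ?_
      rw [Measure.addHaar_sphere_of_ne_zero μ 0 one_ne_zero, add_zero]
  linarith

lemma brouwer_smooth_aux {E : Type*} [NormedAddCommGroup E] [InnerProductSpace ℝ E]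
    [FiniteDimensional ℝ E] (f : E → E) (hf : ContDiff ℝ 1 f)
    (hfB : ∀ x, ‖x‖ ≤ 1 → ‖f x‖ ≤ 1) : ∃ x, ‖x‖ ≤ 1 ∧ f x = x := by
  by_contra hcon
  push Not at hcon
  let u : E → E := fun x => x - f x
  let p : E → ℝ := fun x => inner ℝ x (u x)
  let d : E → ℝ := fun x => p x ^ 2 + ‖u x‖ ^ 2 * (1 - ‖x‖ ^ 2)
  have hu : ContDiff ℝ 1 u := contDiff_id.sub hf
  have hp : ContDiff ℝ 1 p := contDiff_id.inner ℝ hu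
  have hd : ContDiff ℝ 1 d :=
    (hp.pow 2).add ((hu.norm_sq ℝ).mul (contDiff_const.sub (contDiff_id.norm_sq ℝ)))
  let s : E → ℝ := fun x => (Real.sqrt (d x) - p x) / ‖u x‖ ^ 2
  let r : E → E := fun x => x + s x • u x
  let U : Set E := {x | 0 < d x} ∩ {x | u x ≠ 0}
  have hu0 : ∀ x, ‖x‖ ≤ 1 → u x ≠ 0 := fun x hx h0 => hcon x hx (sub_eq_zero.1 h0).symm
  have hpp : ∀ x, ‖x‖ = 1 → 0 < p x := by
    intro x hx
    have h1 : p x = ‖x‖ ^ 2 - inner ℝ x (f x) := by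
      simp only [p, u]; rw [inner_sub_right, real_inner_self_eq_norm_sq]
    have h2 : ‖u x‖ ^ 2 = ‖x‖ ^ 2 - 2 * inner ℝ x (f x) + ‖f x‖ ^ 2 := norm_sub_sq_real _ _
    have h3 : 0 < ‖u x‖ := norm_pos_iff.2 (hu0 x hx.le)
    have h4 := hfB x hx.le
    have h5 : ‖f x‖ ^ 2 ≤ 1 := pow_le_one₀ (norm_nonneg _) h4
    have h6 : 0 < ‖u x‖ ^ 2 := by positivity
    rw [hx] at h1 h2
    nlinarith
  have hdp : ∀ x, ‖x‖ ≤ 1 → 0 < d x := by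
    intro x hx
    rcases hx.lt_or_eq with h | h
    · have h1 : 0 < ‖u x‖ := norm_pos_iff.2 (hu0 x hx)
      have h2 : 0 < 1 - ‖x‖ ^ 2 := by nlinarith [norm_nonneg x]
      simp only [d]; positivity
    · have := hpp x h
      simp only [d]; rw [h]; ring_nf; positivity
  refine no_retract_aux r U ?_ ?_ ?_ ?_ ?_
  · exact (isOpen_lt continuous_const hd.continuous).inter
      (isOpen_ne_fun hu.continuous continuous_const)
  · intro x hx
    have hx : ‖x‖ ≤ 1 := by simpa using hx
    exact ⟨hdp x hx, hu0 x hx⟩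
  · have hs : ContDiffOn ℝ 1 s U := by
      refine ContDiffOn.div ?_ (hu.norm_sq ℝ).contDiffOn ?_
      · exact (hd.contDiffOn.sqrt fun x hx => (hx.1 : 0 < d x).ne').sub hp.contDiffOn
      · intro x hx
        have := norm_pos_iff.2 hx.2
        positivity
    exact contDiffOn_id.add (hs.smul hu.contDiffOn)
  · intro x hx
    have hx : ‖x‖ ≤ 1 := by simpa using hx
    have h1 : 0 < ‖u x‖ := norm_pos_iff.2 (hu0 x hx)
    have h2 : s x * ‖u x‖ ^ 2 = Real.sqrt (d x) - p x := by
      simp only [s]; field_simp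
    have h3 : Real.sqrt (d x) ^ 2 = d x := Real.sq_sqrt (hdp x hx).le
    have h4 : ‖r x‖ ^ 2 = ‖x‖ ^ 2 + 2 * (s x * p x) + s x ^ 2 * ‖u x‖ ^ 2 := by
      simp only [r]
      rw [norm_add_sq_real, inner_smul_right, norm_smul, mul_pow, Real.norm_eq_abs, sq_abs]
    have h5 : ‖u x‖ ^ 2 * (‖r x‖ ^ 2 - 1) = 0 := by
      have h6 : Real.sqrt (d x) = s x * ‖u x‖ ^ 2 + p x := by linarith
      rw [h6] at h3
      simp only [d] at h3
      rw [h4]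
      linear_combination h3
    have h7 : ‖r x‖ ^ 2 = 1 := by
      rcases mul_eq_zero.1 h5 with h | h
      · exact absurd h (by positivity)
      · linarith
    exact (pow_eq_one_iff_of_nonneg (norm_nonneg _) two_ne_zero).1 h7
  · intro x hx
    have h1 : d x = p x ^ 2 := by simp only [d]; rw [hx]; ring
    have h2 : s x = 0 := by
      simp only [s]; rw [h1, Real.sqrt_sq (hpp x hx).le]; simp
    simp [r, h2]

/-- Brouwer fixed point theorem on the closed unit ball. -/
lemma brouwer_aux {E : Type*} [NormedAddCommGroup E] [InnerProductSpace ℝ E]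
    [FiniteDimensional ℝ E] (f : E → E) (hf : Continuous f)
    (hfB : ∀ x, ‖x‖ ≤ 1 → ‖f x‖ ≤ 1) : ∃ x, ‖x‖ ≤ 1 ∧ f x = x := by
  by_contra hcon
  push Not at hcon
  obtain ⟨x0, hx0, hmin⟩ := (isCompact_closedBall (0 : E) 1).exists_isMinOn
    ⟨0, by simp⟩ (f := fun x => ‖f x - x‖) (by fun_prop)
  set η := ‖f x0 - x0‖ with hη
  have hη0 : 0 < η := norm_pos_iff.2 (sub_ne_zero.2 (hcon x0 (by simpa using hx0)))
  obtain ⟨g, hg, hgf, -⟩ := hf.exists_contDiff_approx 1 (ε := fun _ => η / 2) continuous_const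
    (fun _ => by positivity)
  have hk : 0 < 1 + η / 2 := by positivity
  have hgn : ∀ x, ‖x‖ ≤ 1 → ‖g x‖ ≤ 1 + η / 2 := by
    intro x hx
    have h1 := hgf x
    rw [dist_eq_norm] at h1
    have h2 := norm_le_norm_add_norm_sub' (g x) (f x)
    linarith [hfB x hx]
  obtain ⟨x, hx, hfix⟩ := brouwer_smooth_aux (fun x => (1 + η / 2)⁻¹ • g x)
    ((hg.of_le (by simp)).const_smul _) (by
      intro x hx
      rw [norm_smul, norm_inv, Real.norm_of_nonneg hk.le, inv_mul_le_iff₀ hk]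
      simpa using hgn x hx)
  have hfix : (1 + η / 2)⁻¹ • g x = x := hfix
  have h1 : g x - x = (η / 2) • x := by
    have : g x = (1 + η / 2) • x := by
      rw [← hfix, smul_smul, mul_inv_cancel₀ hk.ne', one_smul, hfix]
    rw [this, add_smul, one_smul]; abel
  have h2 : ‖g x - x‖ ≤ η / 2 := by
    rw [h1, norm_smul, Real.norm_of_nonneg (by positivity)]
    nlinarith
  have h3 : η ≤ ‖f x - x‖ := hmin (by simpa using hx)
  have h4 := hgf x
  rw [dist_eq_norm, norm_sub_rev] at h4
  have h5 := norm_sub_le_norm_sub_add_norm_sub (f x) (g x) x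
  linarith

/-- Schauder fixed point theorem. -/
lemma schauder_aux {E : Type*} [NormedAddCommGroup E] [NormedSpace ℝ E] (A : Set E)
    (hA : IsCompact A) (hc : Convex ℝ A) (hne : A.Nonempty) (Φ : E → E) (hΦ : Continuous Φ)
    (hm : ∀ x ∈ A, Φ x ∈ A) : ∃ x ∈ A, Φ x = x := by
  classical
  by_contra hcon
  push Not at hcon
  obtain ⟨x0, hx0, hmin⟩ := hA.exists_isMinOn hne (f := fun x => ‖Φ x - x‖) (by fun_prop)
  set η := ‖Φ x0 - x0‖ with hη
  have hη0 : 0 < η := norm_pos_iff.2 (sub_ne_zero.2 (hcon x0 hx0))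
  obtain ⟨t, htA, htf, hcov⟩ := hA.finite_cover_balls hη0
  have : Fintype t := htf.fintype
  have htne : t.Nonempty := by
    obtain ⟨y, hy⟩ := hne
    obtain ⟨z, hz, -⟩ := mem_iUnion₂.1 (hcov hy)
    exact ⟨z, hz⟩
  have : Nonempty t := htne.to_subtype
  set m : ℝ := (Fintype.card t : ℝ) with hmdef
  have hm0 : 0 < m := by
    have h := Fintype.card_pos (α := t)
    rw [hmdef]
    exact_mod_cast h
  -- retraction onto the simplex
  let S : EuclideanSpace ℝ t → ℝ := fun w => ∑ i, max (w i) 0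
  have hScont : Continuous S := by fun_prop
  have hS0 : ∀ w, 0 ≤ S w := fun w => Finset.sum_nonneg fun i _ => le_max_right _ _
  let ρ : EuclideanSpace ℝ t → t → ℝ := fun w i => max (w i) 0 / max 1 (S w) + (1 - S w / max 1 (S w)) / m
  have hρc : ∀ i, Continuous fun w => ρ w i := by
    intro i
    have h1 : ∀ w, max 1 (S w) ≠ 0 := fun w => by positivity
    have h2 : Continuous fun w : EuclideanSpace ℝ t => max (w i) 0 := by fun_prop
    have h3 : Continuous fun w : EuclideanSpace ℝ t => max 1 (S w) := by fun_prop
    exact (h2.div h3 h1).add ((continuous_const.sub (hScont.div h3 h1)).div_const _)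
  have hρ0 : ∀ w i, 0 ≤ ρ w i := by
    intro w i
    have h1 : S w / max 1 (S w) ≤ 1 := div_le_one_of_le₀ (le_max_right _ _) (by positivity)
    have h2 : 0 ≤ 1 - S w / max 1 (S w) := by linarith
    simp only [ρ]; positivity
  have hρ1 : ∀ w, ∑ i, ρ w i = 1 := by
    intro w
    simp only [ρ]
    rw [Finset.sum_add_distrib, ← Finset.sum_div, Finset.sum_const, Finset.card_univ, nsmul_eq_mul]
    rw [← hmdef, mul_div_cancel₀ _ hm0.ne']
    simp only [S]; ring
  let q : EuclideanSpace ℝ t → E := fun w => ∑ i, ρ w i • (i : E)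
  have hqc : Continuous q := continuous_finsetSum _ fun i _ => (hρc i).smul continuous_const
  have hqA : ∀ w, q w ∈ A := fun w =>
    hc.sum_mem (fun i _ => hρ0 w i) (hρ1 w) (fun i _ => htA i.2)
  let l : E → t → ℝ := fun y i => max (η - ‖y - i‖) 0
  have hl0 : ∀ y i, 0 ≤ l y i := fun y i => le_max_right _ _
  have hlc : ∀ i, Continuous fun y => l y i := by intro i; fun_prop
  have hlp : ∀ y ∈ A, 0 < ∑ i, l y i := by
    intro y hy
    obtain ⟨z, hz, hyz⟩ := mem_iUnion₂.1 (hcov hy)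
    refine Finset.sum_pos' (fun i _ => hl0 y i) ⟨⟨z, hz⟩, Finset.mem_univ _, ?_⟩
    rw [Metric.mem_ball, dist_eq_norm] at hyz
    exact lt_max_of_lt_left (by simpa using hyz)
  let G : EuclideanSpace ℝ t → EuclideanSpace ℝ t := fun w => WithLp.toLp 2 fun i => l (Φ (q w)) i / ∑ j, l (Φ (q w)) j
  have hGc : Continuous G := by
    refine (PiLp.continuous_toLp 2 _).comp (continuous_pi fun i => ?_)
    have h1 : Continuous fun w => Φ (q w) := hΦ.comp hqc
    refine ((hlc i).comp h1).div (continuous_finsetSum _ fun j _ => (hlc j).comp h1) ?_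
    intro w
    exact (hlp _ (hm _ (hqA w))).ne'
  have hG0 : ∀ w i, 0 ≤ G w i := fun w i =>
    div_nonneg (hl0 _ _) (Finset.sum_nonneg fun j _ => hl0 _ _)
  have hG1 : ∀ w, ∑ i, G w i = 1 := by
    intro w
    simp only [G]
    rw [← Finset.sum_div]
    exact div_self (hlp _ (hm _ (hqA w))).ne'
  obtain ⟨w, -, hw⟩ := brouwer_aux G hGc (by
    intro w _
    have h1 : ‖G w‖ ^ 2 ≤ 1 := by
      rw [EuclideanSpace.norm_sq_eq, ← hG1 w]
      refine Finset.sum_le_sum fun i _ => ?_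
      have h2 : G w i ≤ 1 := by
        rw [← hG1 w]
        exact Finset.single_le_sum (fun j _ => hG0 w j) (Finset.mem_univ i)
      rw [Real.norm_of_nonneg (hG0 w i)]
      nlinarith [hG0 w i]
    exact (sq_le_one_iff₀ (norm_nonneg _)).1 h1)
  have hw0 : ∀ i, 0 ≤ w i := fun i => by rw [← hw]; exact hG0 w i
  have hw1 : ∑ i, w i = 1 := by
    have := hG1 w
    rwa [hw] at this
  have hSw : S w = 1 := by
    simp only [S]; rw [← hw1]
    exact Finset.sum_congr rfl fun i _ => max_eq_left (hw0 i)
  have hρw : ∀ i, ρ w i = w i := by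
    intro i
    simp [ρ, hSw, max_eq_left (hw0 i)]
  set y := Φ (q w) with hy
  have hyA : y ∈ A := hm _ (hqA w)
  have hwi : ∀ i, w i = l y i / ∑ j, l y j := by
    intro i
    conv_lhs => rw [← hw]
  have hle : ‖y - q w‖ < η := by
    have h1 : y - q w = ∑ i, w i • (y - (i : E)) := by
      simp only [smul_sub, Finset.sum_sub_distrib, ← Finset.sum_smul, hw1, one_smul, q, hρw]
    rw [h1]
    refine (norm_sum_le _ _).trans_lt ?_
    have h2 : ∀ i ∈ Finset.univ, ‖w i • (y - (i : E))‖ ≤ w i * η := by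
      intro i _
      rw [norm_smul, Real.norm_of_nonneg (hw0 i)]
      by_cases h : η ≤ ‖y - (i : E)‖
      · have : l y i = 0 := max_eq_right (by linarith)
        rw [hwi, this]; simp
      · push Not at h
        exact mul_le_mul_of_nonneg_left h.le (hw0 i)
    have h3 : ∃ i ∈ Finset.univ, ‖w i • (y - (i : E))‖ < w i * η := by
      have : ∃ i ∈ Finset.univ, 0 < w i := by
        by_contra hno
        push Not at hno
        have := Finset.sum_nonpos hno
        rw [hw1] at this
        linarith
      obtain ⟨i, hi, hpos⟩ := this
      refine ⟨i, hi, ?_⟩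
      rw [norm_smul, Real.norm_of_nonneg (hw0 i)]
      refine mul_lt_mul_of_pos_left ?_ hpos
      by_contra h
      push Not at h
      have : l y i = 0 := max_eq_right (by linarith)
      rw [hwi, this] at hpos
      simp at hpos
    calc _ < ∑ i, w i * η := Finset.sum_lt_sum h2 h3
      _ = η := by rw [← Finset.sum_mul, hw1, one_mul]
  have : η ≤ ‖y - q w‖ := hmin (hqA w)
  linarith

lemma periodic_sol_aux {E : Type*} [NormedAddCommGroup E] [NormedSpace ℝ E]
    [FiniteDimensional ℝ E] (F : ℝ → E → E) (hF : Continuous fun q : ℝ × E => F q.1 q.2)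
    (T : ℝ) (hT : 0 < T) (hper : ∀ t x, F (t + T) x = F t x)
    (B : E →L[ℝ] E) (hB : ∀ x, B x = 0 → x = 0) (a : E) (r C ε : ℝ) (hr : 0 ≤ r)
    (hC0 : 0 ≤ C) (hC : ∀ t ∈ Icc 0 T, ∀ x, ‖F t x‖ ≤ C)
    (hinv : ∀ x : ℝ → E, Continuous x → ‖x 0 - a‖ ≤ r →
      (∀ s ∈ Icc 0 T, ‖x s - x 0‖ ≤ |ε| * C * T) →
      ‖x 0 - a - B ((1 / T) • ∫ s in (0:ℝ)..T, F s (x s))‖ ≤ r) :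
    ∃ x : ℝ → E, (∀ t, x (t + T) = x t) ∧ (∀ t, HasDerivAt x (ε • F t (x t)) t) ∧
      ∀ t, ‖x t - a‖ ≤ r + |ε| * C * T := by
  have hT0 := hT.le
  let I := Icc (0:ℝ) T
  let z0 : I := ⟨0, by simp [I, hT0]⟩
  let ext : C(I, E) → ℝ → E := fun x s => x (projIcc 0 T hT0 s)
  have hext : Continuous fun p : C(I, E) × ℝ => ext p.1 p.2 := by
    have h1 : Continuous fun p : C(I, E) × ℝ => (p.1, projIcc 0 T hT0 p.2) :=
      continuous_fst.prodMk (continuous_projIcc.comp continuous_snd)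
    exact (ContinuousEval.continuous_eval).comp h1
  have hext1 : ∀ x, Continuous (ext x) := fun x => x.continuous.comp continuous_projIcc
  have hFx : ∀ x, Continuous fun s => F s (ext x s) := fun x =>
    hF.comp (continuous_id.prodMk (hext1 x))
  let P : C(I, E) → ℝ → E := fun x t => x z0 - B ((1 / T) • ∫ s in (0:ℝ)..T, F s (ext x s))
      + ε • ∫ s in (0:ℝ)..t, F s (ext x s)
  have hPc : Continuous fun p : C(I, E) × I => P p.1 p.2 := by
    have hi : Continuous (Function.uncurry fun (p : C(I, E) × I) (s : ℝ) => F s (ext p.1 s)) := by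
      have h0 : Continuous fun p : (C(I, E) × I) × ℝ => ext p.1.1 p.2 :=
        hext.comp ((continuous_fst.comp continuous_fst).prodMk continuous_snd)
      exact hF.comp (continuous_snd.prodMk h0)
    have h1 : Continuous fun p : C(I, E) × I => ∫ s in (0:ℝ)..T, F s (ext p.1 s) :=
      intervalIntegral.continuous_parametric_intervalIntegral_of_continuous hi continuous_const
    have h2 : Continuous fun p : C(I, E) × I => ∫ s in (0:ℝ)..(p.2 : ℝ), F s (ext p.1 s) :=
      intervalIntegral.continuous_parametric_intervalIntegral_of_continuous hi
        (continuous_subtype_val.comp continuous_snd)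
    have h3 : Continuous fun p : C(I, E) × I => p.1 z0 :=
      (ContinuousEvalConst.continuous_eval_const z0).comp continuous_fst
    exact (h3.sub (B.continuous.comp (h1.const_smul _))).add (h2.const_smul _)
  let Φ : C(I, E) → C(I, E) := fun x => ⟨fun t => P x t, hPc.comp (continuous_const.prodMk continuous_id)⟩
  have hΦ : Continuous Φ := ContinuousMap.continuous_of_continuous_uncurry _ hPc
  let L := |ε| * C
  have hL : 0 ≤ L := by positivity
  let A : Set C(I, E) := {x | ‖x z0 - a‖ ≤ r ∧ ∀ s t : I, ‖x s - x t‖ ≤ L * |(s:ℝ) - t|}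
  have hAz : ∀ x ∈ A, ∀ t : I, ‖x t - x z0‖ ≤ |ε| * C * T := by
    intro x hx t
    refine (hx.2 t z0).trans ?_
    have : |(t:ℝ) - (z0 : ℝ)| ≤ T := by
      simp only [z0, sub_zero]; rw [abs_of_nonneg t.2.1]; exact t.2.2
    exact mul_le_mul_of_nonneg_left this hL
  have hAa : ∀ x ∈ A, ∀ t : I, ‖x t - a‖ ≤ r + |ε| * C * T := by
    intro x hx t
    have h1 := norm_sub_le_norm_sub_add_norm_sub (x t) (x z0) a
    linarith [hAz x hx t, hx.1]
  have hAcl : IsClosed A := by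
    have he : ∀ t : I, Continuous fun x : C(I, E) => x t := fun t =>
      ContinuousEvalConst.continuous_eval_const t
    have : A = {x | ‖x z0 - a‖ ≤ r} ∩ ⋂ s : I, ⋂ t : I, {x | ‖x s - x t‖ ≤ L * |(s:ℝ) - t|} := by
      ext x; simp [A]
    rw [this]
    refine (isClosed_le ((he z0).sub continuous_const).norm continuous_const).inter ?_
    refine isClosed_iInter fun s => isClosed_iInter fun t => ?_
    exact isClosed_le ((he s).sub (he t)).norm continuous_const
  have hAcomp : IsCompact A := by
    let hiso := ContinuousMap.isometryEquivBoundedOfCompact I E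
    have h1 : IsCompact (hiso '' A) := by
      apply BoundedContinuousFunction.arzela_ascoli₂ (Metric.closedBall a (r + |ε| * C * T))
        (isCompact_closedBall _ _)
      · exact hiso.toHomeomorph.isClosedMap _ hAcl
      · rintro _ t ⟨x, hx, rfl⟩
        rw [Metric.mem_closedBall, dist_eq_norm]
        exact hAa x hx t
      · refine Metric.equicontinuous_of_continuity_modulus (fun d => L * d) ?_ _ ?_
        · have : Filter.Tendsto (fun d => L * d) (nhds 0) (nhds (L * 0)) :=
            (continuous_const.mul continuous_id).tendsto 0
          simpa using this
        · rintro s t ⟨_, x, hx, rfl⟩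
          rw [dist_eq_norm]
          exact hx.2 s t
    exact hiso.toHomeomorph.isCompact_image.1 h1
  have hAconv : Convex ℝ A := by
    intro x hx y hy α β hα hβ hαβ
    refine ⟨?_, fun s t => ?_⟩
    · have : (α • x + β • y) z0 - a = α • (x z0 - a) + β • (y z0 - a) := by
        simp only [ContinuousMap.add_apply, ContinuousMap.smul_apply, smul_sub]
        nth_rw 1 [← one_smul ℝ a, ← hαβ, add_smul]; abel
      rw [this]
      refine (norm_add_le _ _).trans ?_
      rw [norm_smul, norm_smul, Real.norm_of_nonneg hα, Real.norm_of_nonneg hβ]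
      calc _ ≤ α * r + β * r := by gcongr; exacts [hx.1, hy.1]
        _ = r := by rw [← add_mul, hαβ, one_mul]
    · have : (α • x + β • y) s - (α • x + β • y) t = α • (x s - x t) + β • (y s - y t) := by
        simp only [ContinuousMap.add_apply, ContinuousMap.smul_apply, smul_sub]; abel
      rw [this]
      refine (norm_add_le _ _).trans ?_
      rw [norm_smul, norm_smul, Real.norm_of_nonneg hα, Real.norm_of_nonneg hβ]
      calc _ ≤ α * (L * |(s:ℝ) - t|) + β * (L * |(s:ℝ) - t|) := by
            gcongr; exacts [hx.2 s t, hy.2 s t]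
        _ = _ := by rw [← add_mul, hαβ, one_mul]
  have hAne : A.Nonempty := ⟨ContinuousMap.const _ a, by simp [hr], fun s t => by
    simp; positivity⟩
  have hext0 : ∀ x, ext x 0 = x z0 := by
    intro x; simp [ext, z0, projIcc_left]
  have hmaps : ∀ x ∈ A, Φ x ∈ A := by
    intro x hx
    refine ⟨?_, fun s t => ?_⟩
    · have h1 := hinv (ext x) (hext1 x) (by rw [hext0]; exact hx.1) (by
        intro s _
        rw [hext0]; exact hAz x hx _)
      have h2 : Φ x z0 - a = ext x 0 - a - B ((1 / T) • ∫ s in (0:ℝ)..T, F s (ext x s)) := by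
        simp only [Φ, P, ContinuousMap.coe_mk, z0, intervalIntegral.integral_same, hext0]
        simp only [smul_zero, add_zero]; abel
      rw [h2]; exact h1
    · have h1 : Φ x s - Φ x t = ε • ∫ u in (t:ℝ)..s, F u (ext x u) := by
        simp only [Φ, P, ContinuousMap.coe_mk]
        rw [add_sub_add_left_eq_sub, ← smul_sub, intervalIntegral.integral_interval_sub_left
          ((hFx x).intervalIntegrable _ _) ((hFx x).intervalIntegrable _ _)]
      rw [h1, norm_smul, Real.norm_eq_abs, mul_assoc]
      refine mul_le_mul_of_nonneg_left ?_ (abs_nonneg _)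
      apply intervalIntegral.norm_integral_le_of_norm_le_const
      intro u hu
      apply hC
      have := uIoc_subset_uIcc hu
      exact (uIcc_subset_Icc t.2 s.2) this
  obtain ⟨x, hxA, hfix⟩ := schauder_aux A hAcomp hAconv hAne Φ hΦ hmaps
  have hPx : ∀ t : I, P x t = x t := fun t => DFunLike.congr_fun hfix t
  have havg : ∫ s in (0:ℝ)..T, F s (ext x s) = 0 := by
    have h1 := hPx z0
    simp only [P, z0, intervalIntegral.integral_same, smul_zero, add_zero] at h1
    have h2 := hB _ (sub_eq_self.1 h1)
    exact (smul_eq_zero.1 h2).resolve_left (by positivity)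
  have hsol : ∀ t ∈ Icc 0 T, ext x t = x z0 + ε • ∫ s in (0:ℝ)..t, F s (ext x s) := by
    intro t ht
    have h1 := hPx ⟨t, ht⟩
    simp only [P, havg, smul_zero, map_zero, sub_zero] at h1
    simp only [ext]; rw [projIcc_of_mem _ ht, ← h1]
  -- periodic extension
  let X : ℝ → E := fun t => ext x (toIcoMod hT 0 t)
  have hXI : ∀ t ∈ Icc 0 T, X t = ext x t := by
    intro t ht
    rcases ht.2.lt_or_eq with h | h
    · simp only [X]
      rw [(toIcoMod_eq_self hT).2 ⟨ht.1, by simpa using h⟩]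
    · simp only [X]
      rw [h, hsol T ⟨hT0, le_rfl⟩, havg, smul_zero, add_zero, ← hext0]
      congr 1
      simpa using toIcoMod_add_right hT 0 0
  have hXper : ∀ t, X (t + T) = X t := fun t => by simp only [X]; rw [toIcoMod_add_right]
  let g : ℝ → E := fun s => F s (X s)
  have hgper : Function.Periodic g T := fun t => by simp only [g]; rw [hper, hXper]
  have hgI : ∀ t ∈ Icc 0 T, ∫ s in (0:ℝ)..t, g s = ∫ s in (0:ℝ)..t, F s (ext x s) := by
    intro t ht
    refine intervalIntegral.integral_congr fun s hs => ?_
    rw [uIcc_of_le ht.1] at hs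
    simp only [g]; rw [hXI s ⟨hs.1, hs.2.trans ht.2⟩]
  have hgint : ∀ t₁ t₂, IntervalIntegrable g MeasureTheory.volume t₁ t₂ := by
    refine hgper.intervalIntegrable₀ hT.ne' ?_
    refine ((hFx x).intervalIntegrable 0 T).congr ?_
    intro s hs
    rw [uIoc_of_le hT0] at hs
    simp only [g]; rw [hXI s ⟨hs.1.le, hs.2⟩]
  let Y : ℝ → E := fun t => x z0 + ε • ∫ s in (0:ℝ)..t, g s
  have hYper : Function.Periodic Y T := by
    intro t
    simp only [Y]
    rw [hgper.intervalIntegral_add_eq_add 0 t hgint, zero_add, hgI T ⟨hT0, le_rfl⟩, havg, add_zero]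
  have hXY : X = Y := by
    funext t
    have h1 : X t = X (toIcoMod hT 0 t) := by
      simp only [X]; rw [toIcoMod_toIcoMod]
    have h2 : Y t = Y (toIcoMod hT 0 t) := by
      rw [toIcoMod]; exact (hYper.sub_zsmul_eq _).symm
    have hmem : toIcoMod hT 0 t ∈ Icc 0 T := by
      have := toIcoMod_mem_Ico hT 0 t
      rw [zero_add] at this
      exact ⟨this.1, this.2.le⟩
    rw [h1, h2, hXI _ hmem, hsol _ hmem]
    simp only [Y]; rw [hgI _ hmem]
  have hYc : Continuous Y :=
    continuous_const.add ((intervalIntegral.continuous_primitive hgint 0).const_smul ε)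
  have hgc : Continuous g := by
    simp only [g]; rw [hXY]; exact hF.comp (continuous_id.prodMk hYc)
  refine ⟨X, hXper, fun t => ?_, fun t => hAa x hxA _⟩
  have h1 : HasDerivAt Y (ε • g t) t :=
    ((hgc.integral_hasStrictDerivAt 0 t).hasDerivAt.const_smul ε).const_add _
  rw [← hXY] at h1
  exact h1

/-- Averaging theorem, `C¹` version of Theorem 3.4. Consider
`x'(t) = ε H(t,x) + ε² K(t,x,ε)`, with `H : ℝ × D → ℝⁿ` and
`K : ℝ × D × (-ε₀,ε₀) → ℝⁿ` continuous and `T`-periodic in the first variable, `D ⊆ ℝⁿ`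
open. Let `h(z) = (1/T) ∫_0^T H(t,z) dt` be the averaged function; suppose `h` is `C¹`,
`h(a) = 0` and `det Dh(a) ≠ 0` for some `a ∈ D`. Then for each `|ε| > 0` small enough
there is a `T`-periodic solution `φ(·,ε)` of the system, and `φ(·,ε) → a` (uniformly)
as `ε → 0`. -/
theorem statement14 (n : ℕ) (D : Set (Fin n → ℝ)) (hD : IsOpen D)
    (T : ℝ) (hT : 0 < T) (ε₀ : ℝ) (hε₀ : 0 < ε₀)
    (H : ℝ → (Fin n → ℝ) → (Fin n → ℝ))
    (K : ℝ → (Fin n → ℝ) → ℝ → (Fin n → ℝ))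
    (hHcont : ContinuousOn (fun q : ℝ × (Fin n → ℝ) => H q.1 q.2) (univ ×ˢ D))
    (hKcont : ContinuousOn (fun q : ℝ × (Fin n → ℝ) × ℝ => K q.1 q.2.1 q.2.2)
      (univ ×ˢ D ×ˢ Ioo (-ε₀) ε₀))
    (hHper : ∀ t x, H (t + T) x = H t x)
    (hKper : ∀ t x ε, K (t + T) x ε = K t x ε)
    (h : (Fin n → ℝ) → (Fin n → ℝ))
    (hdef : ∀ z ∈ D, h z = (1 / T) • ∫ t in (0:ℝ)..T, H t z)
    (hC1 : ContDiffOn ℝ 1 h D)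
    (a : Fin n → ℝ) (ha : a ∈ D) (hza : h a = 0)
    (hdet : LinearMap.det (fderiv ℝ h a).toLinearMap ≠ 0) :
    ∃ ε₁ > 0, ε₁ ≤ ε₀ ∧ ∃ φ : ℝ → ℝ → (Fin n → ℝ),
      (∀ ε : ℝ, ε ≠ 0 → |ε| < ε₁ →
        (∀ t, φ ε t ∈ D) ∧
        (∀ t, HasDerivAt (φ ε) (ε • H t (φ ε t) + (ε ^ 2) • K t (φ ε t) ε) t) ∧
        (∀ t, φ ε (t + T) = φ ε t)) ∧
      (∀ δ > 0, ∃ ε₂ > 0, ε₂ ≤ ε₁ ∧ ∀ ε : ℝ, ε ≠ 0 → |ε| < ε₂ →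
        ∀ t, dist (φ ε t) a < δ) := by
  classical
  -- small closed ball inside `D`
  obtain ⟨R, hR, hRD⟩ := Metric.nhds_basis_closedBall.mem_iff.1 (hD.mem_nhds ha)
  let cl : (Fin n → ℝ) → (Fin n → ℝ) := fun x i => max (a i - R) (min (a i + R) (x i))
  have hclc : Continuous cl := by fun_prop
  have hclm : ∀ x, cl x ∈ Metric.closedBall a R := by
    intro x
    rw [Metric.mem_closedBall, dist_pi_le_iff hR.le]
    intro i
    rw [Real.dist_eq, abs_le]
    constructor
    · have := le_max_left (a i - R) (min (a i + R) (x i))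
      simp only [cl]; linarith
    · have : max (a i - R) (min (a i + R) (x i)) ≤ a i + R :=
        max_le (by linarith) (min_le_left _ _)
      simp only [cl]; linarith
  have hcle : ∀ x ∈ Metric.closedBall a R, cl x = x := by
    intro x hx
    rw [Metric.mem_closedBall, dist_pi_le_iff hR.le] at hx
    funext i
    have := hx i
    rw [Real.dist_eq, abs_le] at this
    simp only [cl]
    rw [min_eq_right (by linarith), max_eq_right (by linarith)]
  have hclD : ∀ x, cl x ∈ D := fun x => hRD (hclm x)
  have hHc : Continuous fun q : ℝ × (Fin n → ℝ) => H q.1 (cl q.2) :=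
    hHcont.comp_continuous (f := fun q : ℝ × (Fin n → ℝ) => (q.1, cl q.2)) (by fun_prop)
      (fun q => ⟨mem_univ _, hclD _⟩)
  have hKc : ∀ ε ∈ Ioo (-ε₀) ε₀, Continuous fun q : ℝ × (Fin n → ℝ) => K q.1 (cl q.2) ε := by
    intro ε hε
    exact hKcont.comp_continuous (f := fun q : ℝ × (Fin n → ℝ) => (q.1, cl q.2, ε)) (by fun_prop)
      (fun q => ⟨mem_univ _, hclD _, hε⟩)
  -- bounds
  have hcb : IsCompact (Metric.closedBall a R) := isCompact_closedBall _ _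
  have hHcomp : IsCompact (Icc 0 T ×ˢ Metric.closedBall a R) := isCompact_Icc.prod hcb
  have hHon : ContinuousOn (fun q : ℝ × (Fin n → ℝ) => H q.1 q.2) (Icc 0 T ×ˢ Metric.closedBall a R) :=
    hHcont.mono (prod_mono (subset_univ _) hRD)
  obtain ⟨M₁, hM₁⟩ := hHcomp.exists_bound_of_continuousOn hHon
  obtain ⟨M₂, hM₂⟩ := (isCompact_Icc.prod (hcb.prod
    (isCompact_Icc (a := -(ε₀ / 2)) (b := ε₀ / 2)))).exists_bound_of_continuousOn
    (hKcont.mono (prod_mono (subset_univ (Icc 0 T)) (prod_mono hRD (by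
      intro e he; exact ⟨by linarith [he.1], by linarith [he.2]⟩))))
  let M := max 1 (max M₁ M₂)
  have hM0 : 1 ≤ M := le_max_left _ _
  have hMH : ∀ t ∈ Icc 0 T, ∀ x, ‖H t (cl x)‖ ≤ M := fun t ht x =>
    (hM₁ (t, cl x) ⟨ht, hclm x⟩).trans ((le_max_left _ _).trans (le_max_right _ _))
  have hMK : ∀ t ∈ Icc 0 T, ∀ x, ∀ ε, |ε| ≤ ε₀ / 2 → ‖K t (cl x) ε‖ ≤ M := fun t ht x ε hε =>
    (hM₂ (t, cl x, ε) ⟨ht, hclm x, abs_le.1 hε⟩).trans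
      ((le_max_right _ _).trans (le_max_right _ _))
  -- the inverse of the derivative
  let L := fderiv ℝ h a
  let e : (Fin n → ℝ) ≃L[ℝ] (Fin n → ℝ) := (LinearMap.equivOfDetNeZero L.toLinearMap hdet).toContinuousLinearEquiv
  have he : ∀ x, e x = L x := fun x => rfl
  let B : (Fin n → ℝ) →L[ℝ] (Fin n → ℝ) := e.symm
  have hBL : ∀ x, B (L x) = x := fun x => by rw [← he]; exact e.symm_apply_apply x
  have hB0 : ∀ x, B x = 0 → x = 0 := fun x hx => by
    have : e.symm x = 0 := hx
    simpa using this
  have hdiff : HasFDerivAt h L a :=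
    ((hC1.differentiableOn one_ne_zero).differentiableAt (hD.mem_nhds ha)).hasFDerivAt
  set c : ℝ := 1 / (2 * (‖B‖ + 1)) with hc
  have hBn : 0 ≤ ‖B‖ := norm_nonneg _
  have hc0 : 0 < c := by positivity
  have hBc : ‖B‖ * (2 * c) ≤ 1 := by
    rw [hc]; field_simp; linarith
  -- the set of good radii
  let Good : ℝ → ℝ → (ℝ → (Fin n → ℝ)) → Prop := fun ε δ x =>
    (∀ t, x t ∈ D) ∧ (∀ t, HasDerivAt x (ε • H t (x t) + (ε ^ 2) • K t (x t) ε) t) ∧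
      (∀ t, x (t + T) = x t) ∧ ∀ t, dist (x t) a < δ
  have key : ∀ δ > 0, ∃ ε₂ > 0, ε₂ ≤ ε₀ ∧ ∀ ε : ℝ, |ε| < ε₂ → ∃ x, Good ε δ x := by
    intro δ hδ
    obtain ⟨r₀, hr₀, hr₀h⟩ := Metric.eventually_nhds_iff.1 (hdiff.isLittleO.bound hc0)
    let r := min (r₀ / 2) (min (δ / 2) (R / 2))
    have hr : 0 < r := by positivity
    have hr1 : r < r₀ := lt_of_le_of_lt (min_le_left _ _) (by linarith)
    have hr2 : 2 * r ≤ δ := by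
      have : r ≤ δ / 2 := (min_le_right _ _).trans (min_le_left _ _)
      linarith
    have hr3 : 2 * r ≤ R := by
      have : r ≤ R / 2 := (min_le_right _ _).trans (min_le_right _ _)
      linarith
    obtain ⟨η, hη, hηH⟩ := Metric.uniformContinuousOn_iff.1
      (hHcomp.uniformContinuousOn_of_continuous hHon) (c * r / 2) (by positivity)
    let ε₂ := min (min 1 (ε₀ / 2)) (min (min η r / (2 * M * T)) (c * r / (2 * M)))
    have hε₂ : 0 < ε₂ := by positivity
    have hε₂0 : ε₂ ≤ ε₀ / 2 := (min_le_left _ _).trans (min_le_right _ _)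
    refine ⟨ε₂, hε₂, by linarith, fun ε hε => ?_⟩
    have hε1 : |ε| ≤ 1 := hε.le.trans ((min_le_left _ _).trans (min_le_left _ _))
    have hε0 : |ε| ≤ ε₀ / 2 := hε.le.trans hε₂0
    have hεIoo : ε ∈ Ioo (-ε₀) ε₀ := abs_lt.1 (by linarith)
    have hε3 : |ε| * (2 * M) * T < min η r := by
      have h1 : |ε| < min η r / (2 * M * T) :=
        lt_of_lt_of_le hε ((min_le_right _ _).trans (min_le_left _ _))
      rw [lt_div_iff₀ (by positivity)] at h1
      linarith
    have hε4 : |ε| * M ≤ c * r / 2 := by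
      have h1 : |ε| ≤ c * r / (2 * M) := hε.le.trans ((min_le_right _ _).trans (min_le_right _ _))
      rw [le_div_iff₀ (by positivity)] at h1
      linarith
    let F : ℝ → (Fin n → ℝ) → (Fin n → ℝ) := fun t x => H t (cl x) + ε • K t (cl x) ε
    have hFc : Continuous fun q : ℝ × (Fin n → ℝ) => F q.1 q.2 :=
      hHc.add ((hKc ε hεIoo).const_smul ε)
    obtain ⟨x, hxper, hxd, hxa⟩ := periodic_sol_aux F hFc T hT
      (fun t x => by simp only [F]; rw [hHper, hKper]) B hB0 a r (2 * M) ε hr.le (by linarith)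
      (by
        intro t ht x
        refine (norm_add_le _ _).trans ?_
        rw [norm_smul, Real.norm_eq_abs]
        have h1 := hMH t ht x
        have h2 := hMK t ht x ε hε0
        nlinarith [norm_nonneg (K t (cl x) ε), abs_nonneg ε])
      (by
        intro x hxc hx0 hxs
        have hx0R : x 0 ∈ Metric.closedBall a R := by
          rw [Metric.mem_closedBall, dist_eq_norm]; linarith
        have hxsR : ∀ s ∈ Icc 0 T, x s ∈ Metric.closedBall a R := by
          intro s hs
          rw [Metric.mem_closedBall, dist_eq_norm]
          have h1 := norm_sub_le_norm_sub_add_norm_sub (x s) (x 0) a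
          have h2 := hxs s hs
          have h3 := min_le_right η r
          linarith
        have hH0 : Continuous fun s => H s (x 0) := by
          have h1 : Continuous fun s : ℝ => H s (cl (x 0)) :=
            hHc.comp (f := fun s : ℝ => (s, x 0)) (by fun_prop)
          rwa [hcle _ hx0R] at h1
        have hFi : Continuous fun s => F s (x s) := hFc.comp (continuous_id.prodMk hxc)
        set avg := (1 / T) • ∫ s in (0:ℝ)..T, F s (x s) with havg
        have herr : ‖avg - h (x 0)‖ ≤ c * r := by
          rw [hdef _ (hRD hx0R), havg, ← smul_sub, ← intervalIntegral.integral_sub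
            (hFi.intervalIntegrable _ _) (hH0.intervalIntegrable _ _), norm_smul,
            Real.norm_of_nonneg (by positivity)]
          have h1 : ‖∫ s in (0:ℝ)..T, (F s (x s) - H s (x 0))‖ ≤ (c * r) * |T - 0| := by
            apply intervalIntegral.norm_integral_le_of_norm_le_const
            intro s hs
            rw [uIoc_of_le hT.le] at hs
            have hs' : s ∈ Icc 0 T := ⟨hs.1.le, hs.2⟩
            have h2 : ‖H s (x s) - H s (x 0)‖ < c * r / 2 := by
              have := hηH (s, x s) ⟨hs', hxsR s hs'⟩ (s, x 0) ⟨hs', hx0R⟩ (by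
                rw [Prod.dist_eq, dist_self, max_eq_right dist_nonneg, dist_eq_norm]
                exact lt_of_le_of_lt (hxs s hs') (lt_of_lt_of_le hε3 (min_le_left _ _)))
              rwa [dist_eq_norm] at this
            have h3 := hMK s hs' (x s) ε hε0
            have h4 : F s (x s) - H s (x 0) = (H s (x s) - H s (x 0)) + ε • K s (cl (x s)) ε := by
              simp only [F]; rw [hcle _ (hxsR s hs')]; abel
            rw [h4]
            refine (norm_add_le _ _).trans ?_
            rw [norm_smul, Real.norm_eq_abs]
            have h5 : |ε| * ‖K s (cl (x s)) ε‖ ≤ |ε| * M :=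
              mul_le_mul_of_nonneg_left h3 (abs_nonneg _)
            linarith
          rw [sub_zero, abs_of_pos hT] at h1
          rw [one_div, inv_mul_le_iff₀ hT]
          linarith
        have hlin : ‖h (x 0) - L (x 0 - a)‖ ≤ c * r := by
          have h1 := hr₀h (y := x 0) (by rw [dist_eq_norm]; linarith)
          rw [hza, sub_zero] at h1
          exact h1.trans (mul_le_mul_of_nonneg_left hx0 hc0.le)
        have hfin : x 0 - a - B avg = - B ((avg - h (x 0)) + (h (x 0) - L (x 0 - a))) := by
          rw [sub_add_sub_cancel, map_sub, hBL]; abel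
        rw [hfin, norm_neg]
        refine (B.le_opNorm _).trans ?_
        have h1 : ‖(avg - h (x 0)) + (h (x 0) - L (x 0 - a))‖ ≤ 2 * c * r :=
          (norm_add_le _ _).trans (by linarith)
        calc _ ≤ ‖B‖ * (2 * c * r) := by gcongr
          _ = (‖B‖ * (2 * c)) * r := by ring
          _ ≤ 1 * r := by gcongr
          _ = r := one_mul r)
    have hxlt : ∀ t, ‖x t - a‖ < 2 * r := fun t => by
      have h1 := hxa t
      have h3 := min_le_right η r
      linarith
    have hxR : ∀ t, x t ∈ Metric.closedBall a R := fun t => by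
      rw [Metric.mem_closedBall, dist_eq_norm]; linarith [hxlt t]
    refine ⟨x, fun t => hRD (hxR t), fun t => ?_, hxper, fun t => ?_⟩
    · have h1 := hxd t
      simp only [F] at h1
      rw [hcle _ (hxR t), smul_add, smul_smul, ← pow_two] at h1
      exact h1
    · rw [dist_eq_norm]; linarith [hxlt t]
  -- selection of the solutions
  obtain ⟨ε₁, hε₁, hε₁0, hsol⟩ := key 1 one_pos
  let S : ℝ → Set ℝ := fun ε => {δ | 0 ≤ δ ∧ ∃ x, Good ε δ x}
  have hSb : ∀ ε, BddBelow (S ε) := fun ε => ⟨0, fun δ hδ => hδ.1⟩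
  have hsel : ∀ ε : ℝ, ∃ x : ℝ → (Fin n → ℝ), ε ≠ 0 → |ε| < ε₁ → Good ε (sInf (S ε) + |ε|) x := by
    intro ε
    by_cases hε : ε ≠ 0 ∧ |ε| < ε₁
    · have hne : (S ε).Nonempty := ⟨1, zero_le_one, hsol ε hε.2⟩
      obtain ⟨δ, ⟨-, x, hx⟩, hδ⟩ := exists_lt_of_csInf_lt hne
        (lt_add_of_pos_right (sInf (S ε)) (abs_pos.2 hε.1))
      exact ⟨x, fun _ _ => ⟨hx.1, hx.2.1, hx.2.2.1, fun t => (hx.2.2.2 t).trans hδ⟩⟩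
    · exact ⟨fun _ => 0, fun h1 h2 => absurd ⟨h1, h2⟩ hε⟩
  choose φ hφ using hsel
  refine ⟨ε₁, hε₁, hε₁0, φ, fun ε h0 h1 => ?_, fun δ hδ => ?_⟩
  · have := hφ ε h0 h1
    exact ⟨this.1, this.2.1, this.2.2.1⟩
  · obtain ⟨ε₂, hε₂, -, h2⟩ := key (δ / 2) (by positivity)
    refine ⟨min ε₁ (min ε₂ (δ / 2)), by positivity, min_le_left _ _, fun ε h0 h1 t => ?_⟩
    have hε1 : |ε| < ε₁ := lt_of_lt_of_le h1 (min_le_left _ _)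
    have hε2 : |ε| < ε₂ := lt_of_lt_of_le h1 ((min_le_right _ _).trans (min_le_left _ _))
    have hε3 : |ε| < δ / 2 := lt_of_lt_of_le h1 ((min_le_right _ _).trans (min_le_right _ _))
    have h3 := (hφ ε h0 hε1).2.2.2 t
    have h4 : sInf (S ε) ≤ δ / 2 := csInf_le (hSb ε) ⟨by positivity, h2 ε hε2⟩
    linarith
end
end
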